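/- arXiv:1109.2274 — 2 statements merged into one kernel-verified Lean document; each statement's English description precedes it below -/
import Mathlib

section
/- Let χ be a Dirichlet character modulo a and ε > 0. Define μ(σ) = 1/6 − (4/9)(σ − 1/2) for 1/2 ≤ σ ≤ 5/7, μ(σ) = (1 − σ)/4 for 5/7 < σ ≤ 1, and μ(σ) = 0 for σ > 1. Then L(σ + it, χ) ≪_{a,ε} |t|^{μ(σ)+ε} uniformly for σ ≥ 1/2 and |t| ≥ 2. -/
open Finset

/-- Correlation of two translates of a finitely supported sequence. -/
private lemma sum_translate_mul_conj (z : ℕ → ℂ) (N H j h : ℕ) (hj : j + h < H) :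
    ∑ m ∈ range (N + H), (if j ≤ m ∧ m - j < N then z (m - j) else 0) *
      (starRingEnd ℂ) (if j + h ≤ m ∧ m - (j + h) < N then z (m - (j + h)) else 0) =
    ∑ n ∈ range (N - h), z (n + h) * (starRingEnd ℂ) (z n) := by
  symm
  refine Finset.sum_of_injOn (fun n => n + (j + h)) ?_ ?_ ?_ ?_
  · intro a _ b _ hab
    simpa using hab
  · intro n hn
    simp only [coe_range, Set.mem_Iio] at hn ⊢
    omega
  · intro m hm hm'
    simp only [coe_range, Set.mem_image, Set.mem_Iio, not_exists, not_and] at hm'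
    by_cases h1 : j ≤ m ∧ m - j < N
    · by_cases h2 : j + h ≤ m ∧ m - (j + h) < N
      · exact absurd (by omega) (hm' (m - (j + h)) (by omega))
      · rw [if_neg h2]; simp
    · rw [if_neg h1]; simp
  · intro n hn
    simp only [mem_range] at hn
    rw [if_pos (by omega), if_pos (by omega)]
    congr 2
    · omega
    · congr 1; omega

private lemma sum_dist_le (G : ℕ → ℝ) (hG : ∀ n, 0 ≤ G n) (H j : ℕ) (hj : j < H) :
    ∑ k ∈ range H, G (Nat.dist j k) ≤ G 0 + 2 * ∑ h ∈ Ico 1 H, G h := by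
  rw [← Finset.sum_range_add_sum_Ico _ hj.le]
  have h1 : ∑ k ∈ range j, G (Nat.dist j k) ≤ ∑ h ∈ Ico 1 H, G h := by
    rw [← Finset.sum_range_reflect, Finset.range_eq_Ico, 
      Finset.sum_congr rfl (g := fun k => G (1 + k)), Finset.sum_Ico_add (fun k => G k) 0 j 1]
    · exact Finset.sum_le_sum_of_subset_of_nonneg (Finset.Ico_subset_Ico (by omega) (by omega))
        (fun i _ _ => hG i)
    · intro k hk
      simp only [mem_Ico] at hk
      congr 1
      rw [Nat.dist_eq_sub_of_le_right (by omega)]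
      omega
  have h2 : ∑ k ∈ Ico j H, G (Nat.dist j k) ≤ G 0 + ∑ h ∈ Ico 1 H, G h := by
    rw [Finset.sum_Ico_eq_sum_range, Finset.sum_congr rfl (g := fun k => G k)]
    · rw [← Finset.sum_eq_sum_Ico_succ_bot (by omega : 0 < H), ← Finset.range_eq_Ico]
      exact Finset.sum_le_sum_of_subset_of_nonneg (Finset.range_subset_range.2 (by omega))
        (fun i _ _ => hG i)
    · intro k hk
      congr 1
      rw [Nat.dist_eq_sub_of_le (by omega)]
      omega
  linarith

/-- **Van der Corput's inequality** for a finite sequence of complex numbers. -/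
theorem van_der_corput_inequality (z : ℕ → ℂ) (N H : ℕ) (hH : 0 < H) :
    H * ‖∑ n ∈ range N, z n‖ ^ 2 ≤
      (N + H) * (‖∑ n ∈ range N, z n * (starRingEnd ℂ) (z n)‖ +
        2 * ∑ h ∈ Ico 1 H, ‖∑ n ∈ range (N - h), z (n + h) * (starRingEnd ℂ) (z n)‖) := by
  set Y : ℕ → ℕ → ℂ := fun m j => if j ≤ m ∧ m - j < N then z (m - j) else 0 with hY
  set G : ℕ → ℝ := fun h => ‖∑ n ∈ range (N - h), z (n + h) * (starRingEnd ℂ) (z n)‖ with hGdef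
  have hcorr : ∀ j ∈ range H, ∀ k ∈ range H,
      ‖∑ m ∈ range (N + H), Y m j * (starRingEnd ℂ) (Y m k)‖ = G (Nat.dist j k) := by
    intro j hj k hk
    simp only [mem_range] at hj hk
    rcases le_total j k with hjk | hjk
    · obtain ⟨h, rfl⟩ := Nat.exists_eq_add_of_le hjk
      rw [hY, sum_translate_mul_conj z N H j h hk, Nat.dist_eq_sub_of_le hjk]
      simp [hGdef]
    · obtain ⟨h, rfl⟩ := Nat.exists_eq_add_of_le hjk
      rw [← Complex.norm_conj, map_sum, Finset.sum_congr rfl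
        (g := fun m => Y m k * (starRingEnd ℂ) (Y m (k + h)))]
      · rw [hY, sum_translate_mul_conj z N H k h hj, Nat.dist_eq_sub_of_le_right hjk]
        simp [hGdef]
      · intro m _
        simp [mul_comm]
  have hsum : ∑ m ∈ range (N + H), ∑ j ∈ range H, Y m j = H * ∑ n ∈ range N, z n := by
    rw [Finset.sum_comm, Finset.sum_congr rfl (g := fun _ => ∑ n ∈ range N, z n)]
    · simp
    · intro j hj
      simp only [mem_range] at hj
      symm
      refine Finset.sum_of_injOn (fun n => n + j) ?_ ?_ ?_ ?_
      · intro a _ b _ hab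
        simpa using hab
      · intro n hn
        simp only [coe_range, Set.mem_Iio] at hn ⊢
        omega
      · intro m hm hm'
        simp only [coe_range, Set.mem_image, Set.mem_Iio, not_exists, not_and] at hm'
        refine if_neg fun h => hm' (m - j) h.2 (by omega)
      · intro n hn
        simp only [mem_range] at hn
        simp [hY, hn]
  have hsq : ∑ m ∈ range (N + H), ‖∑ j ∈ range H, Y m j‖ ^ 2 ≤
      H * (G 0 + 2 * ∑ h ∈ Ico 1 H, G h) := by
    have h1 : ((∑ m ∈ range (N + H), ‖∑ j ∈ range H, Y m j‖ ^ 2 : ℝ) : ℂ) =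
        ∑ j ∈ range H, ∑ k ∈ range H, ∑ m ∈ range (N + H), Y m j * (starRingEnd ℂ) (Y m k) := by
      push_cast
      simp_rw [← Complex.mul_conj', map_sum, Finset.sum_mul_sum]
      rw [Finset.sum_comm]
      refine Finset.sum_congr rfl fun j _ => ?_
      rw [Finset.sum_comm]
    have h2 : ∑ m ∈ range (N + H), ‖∑ j ∈ range H, Y m j‖ ^ 2 =
        ‖((∑ m ∈ range (N + H), ‖∑ j ∈ range H, Y m j‖ ^ 2 : ℝ) : ℂ)‖ := by
      rw [Complex.norm_real, Real.norm_of_nonneg (by positivity)]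
    rw [h2, h1]
    calc _ ≤ ∑ j ∈ range H, ∑ k ∈ range H, G (Nat.dist j k) := by
          refine (norm_sum_le _ _).trans (Finset.sum_le_sum fun j hj => ?_)
          refine (norm_sum_le _ _).trans (Finset.sum_le_sum fun k hk => ?_)
          exact (hcorr j hj k hk).le
      _ ≤ ∑ j ∈ range H, (G 0 + 2 * ∑ h ∈ Ico 1 H, G h) :=
          Finset.sum_le_sum fun j hj =>
            sum_dist_le G (fun _ => norm_nonneg _) H j (mem_range.1 hj)
      _ = _ := by rw [Finset.sum_const, card_range, nsmul_eq_mul]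
  have hcs : (H * ‖∑ n ∈ range N, z n‖) ^ 2 ≤
      (N + H) * ∑ m ∈ range (N + H), ‖∑ j ∈ range H, Y m j‖ ^ 2 := by
    have h1 : (H : ℝ) * ‖∑ n ∈ range N, z n‖ ≤ ∑ m ∈ range (N + H), ‖∑ j ∈ range H, Y m j‖ := by
      calc _ = ‖(H : ℂ) * ∑ n ∈ range N, z n‖ := by simp
        _ ≤ _ := by rw [← hsum]; exact norm_sum_le _ _
    have h2 := sq_sum_le_card_mul_sum_sq (s := range (N + H))
      (f := fun m => ‖∑ j ∈ range H, Y m j‖)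
    rw [card_range] at h2
    push_cast at h2
    exact (pow_le_pow_left₀ (by positivity) h1 2).trans h2
  have hH' : (0 : ℝ) < H := by exact_mod_cast hH
  have hfin : (H : ℝ) * (H * ‖∑ n ∈ range N, z n‖ ^ 2) ≤
      H * ((N + H) * (G 0 + 2 * ∑ h ∈ Ico 1 H, G h)) := by
    calc _ = (H * ‖∑ n ∈ range N, z n‖) ^ 2 := by ring
      _ ≤ _ := hcs
      _ ≤ (N + H) * (H * (G 0 + 2 * ∑ h ∈ Ico 1 H, G h)) := by gcongr
      _ = _ := by ring
  simpa [hGdef] using le_of_mul_le_mul_left hfin hH'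

/-- The exponential sum `∑_{n < N} exp(i f(n))`. -/
noncomputable def expSum (f : ℕ → ℝ) (N : ℕ) : ℂ :=
  ∑ n ∈ range N, Complex.exp (f n * Complex.I)

lemma norm_expSum_le (f : ℕ → ℝ) (N : ℕ) : ‖expSum f N‖ ≤ N := by
  refine (norm_sum_le _ _).trans ?_
  simp [Complex.norm_exp_ofReal_mul_I]

lemma norm_exp_mul_I_sub_one_ge {x : ℝ} (h0 : 0 ≤ x) (hx : x ≤ Real.pi) :
    2 / Real.pi * x ≤ ‖Complex.exp (x * Complex.I) - 1‖ := by
  have h := Real.mul_le_sin (x := x / 2) (by linarith) (by linarith)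
  rw [mul_comm (x : ℂ), Complex.norm_exp_I_mul_ofReal_sub_one, norm_mul, Real.norm_eq_abs,
    Real.norm_eq_abs, abs_of_pos (by norm_num : (0 : ℝ) < 2)]
  have := le_abs_self (Real.sin (x / 2))
  linarith

lemma norm_exp_mul_I_sub_exp_mul_I_le (x y : ℝ) :
    ‖Complex.exp (x * Complex.I) - Complex.exp (y * Complex.I)‖ ≤ |x - y| := by
  have h : Complex.exp (x * Complex.I) - Complex.exp (y * Complex.I) =
      Complex.exp (y * Complex.I) * (Complex.exp (Complex.I * ((x - y : ℝ) : ℂ)) - 1) := by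
    rw [mul_sub, ← Complex.exp_add, mul_one]
    congr 2
    push_cast; ring
  rw [h, norm_mul, Complex.norm_exp_ofReal_mul_I, one_mul]
  exact Real.norm_exp_I_mul_ofReal_sub_one_le

/-- Abel summation against differences. -/
private lemma sum_mul_sub_eq (w z : ℕ → ℂ) (N : ℕ) :
    ∑ n ∈ range (N + 1), w n * (z (n + 1) - z n) =
      w N * z (N + 1) - w 0 * z 0 - ∑ n ∈ range N, z (n + 1) * (w (n + 1) - w n) := by
  induction N with
  | zero => simp; ring
  | succ N ih => rw [sum_range_succ, ih, sum_range_succ _ N]; ring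

/-- **Kusmin–Landau inequality**, for differences decreasing within `[l, π]`. -/
theorem kusmin_landau (f : ℕ → ℝ) (N : ℕ) {l : ℝ} (hl : 0 < l)
    (h1 : ∀ n < N, l ≤ f (n + 1) - f n) (h2 : ∀ n < N, f (n + 1) - f n ≤ Real.pi)
    (h3 : ∀ n, n + 1 < N → f (n + 2) - f (n + 1) ≤ f (n + 1) - f n) :
    ‖expSum f N‖ ≤ 6 / l := by
  obtain _ | N := N
  · simp only [expSum, range_zero, sum_empty, norm_zero]; positivity
  have hpi := Real.pi_pos
  have hpi2 := Real.pi_lt_d2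
  set g : ℕ → ℝ := fun n => f (n + 1) - f n with hg
  set z : ℕ → ℂ := fun n => Complex.exp (f n * Complex.I) with hz
  set e : ℕ → ℂ := fun n => Complex.exp (g n * Complex.I) with he
  have hgl : ∀ n < N + 1, l ≤ g n := h1
  have hgp : ∀ n < N + 1, 0 < g n := fun n hn => hl.trans_le (hgl n hn)
  have hlow : ∀ n < N + 1, 2 / Real.pi * g n ≤ ‖e n - 1‖ := fun n hn =>
    norm_exp_mul_I_sub_one_ge (hgp n hn).le (h2 n hn)
  have hpos : ∀ n < N + 1, 0 < ‖e n - 1‖ := fun n hn =>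
    (mul_pos (by positivity) (hgp n hn)).trans_le (hlow n hn)
  have hne : ∀ n < N + 1, e n - 1 ≠ 0 := fun n hn => norm_pos_iff.1 (hpos n hn)
  have hz1 : ∀ n, ‖z n‖ = 1 := fun n => Complex.norm_exp_ofReal_mul_I _
  set w : ℕ → ℂ := fun n => (e n - 1)⁻¹ with hw
  have hsum : expSum f (N + 1) = ∑ n ∈ range (N + 1), w n * (z (n + 1) - z n) := by
    refine sum_congr rfl fun n hn => ?_
    have hze : z (n + 1) = z n * e n := by
      simp only [hz, he, hg, ← Complex.exp_add]
      congr 1; push_cast; ring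
    rw [hze, ← mul_sub_one, mul_left_comm, inv_mul_cancel₀ (hne n (mem_range.1 hn)), mul_one]
  have hwn : ∀ n < N + 1, ‖w n‖ ≤ Real.pi / 2 / l := by
    intro n hn
    rw [hw, norm_inv, inv_le_comm₀ (hpos n hn) (by positivity)]
    calc _ = 2 / Real.pi * l := by field_simp
      _ ≤ 2 / Real.pi * g n := by gcongr; exact hgl n hn
      _ ≤ _ := hlow n hn
  have hwd : ∀ n ∈ range N, ‖z (n + 1) * (w (n + 1) - w n)‖ ≤
      Real.pi ^ 2 / 4 * (1 / g (n + 1) - 1 / g n) := by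
    intro n hn
    have hn := mem_range.1 hn
    have hn1 : n < N + 1 := by omega
    have hn2 : n + 1 < N + 1 := by omega
    have hg1 := hgp n hn1
    have hg2 := hgp _ hn2
    have hw' : w (n + 1) - w n = (e n - e (n + 1)) / ((e (n + 1) - 1) * (e n - 1)) := by
      simp only [hw]
      field_simp [hne n hn1, hne _ hn2]
      ring
    rw [norm_mul, hz1, one_mul, hw', norm_div, norm_mul]
    have hmono : g (n + 1) ≤ g n := h3 n (by omega)
    calc _ ≤ |g n - g (n + 1)| / ((2 / Real.pi * g (n + 1)) * (2 / Real.pi * g n)) := by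
          gcongr
          · exact norm_exp_mul_I_sub_exp_mul_I_le _ _
          · exact hlow _ hn2
          · exact hlow n hn1
      _ = _ := by
          rw [abs_of_nonneg (by linarith)]
          field_simp
          ring
  have htel : ‖∑ n ∈ range N, z (n + 1) * (w (n + 1) - w n)‖ ≤ Real.pi ^ 2 / 4 * (1 / l) := by
    refine (norm_sum_le _ _).trans ((sum_le_sum hwd).trans ?_)
    rw [← mul_sum, sum_range_sub (fun n => 1 / g n)]
    gcongr
    have h4 : 0 < 1 / g 0 := one_div_pos.2 (hgp 0 (by omega))
    have h5 : 1 / g N ≤ 1 / l := one_div_le_one_div_of_le hl (hgl N (by omega))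
    linarith
  rw [hsum, sum_mul_sub_eq]
  have h6 : ‖w N * z (N + 1)‖ ≤ Real.pi / 2 / l := by
    rw [norm_mul, hz1, mul_one]; exact hwn N (by omega)
  have h7 : ‖w 0 * z 0‖ ≤ Real.pi / 2 / l := by
    rw [norm_mul, hz1, mul_one]; exact hwn 0 (by omega)
  calc _ ≤ Real.pi / 2 / l + Real.pi / 2 / l + Real.pi ^ 2 / 4 * (1 / l) :=
        (norm_sub_le _ _).trans (add_le_add ((norm_sub_le _ _).trans (add_le_add h6 h7)) htel)
    _ = (Real.pi + Real.pi ^ 2 / 4) / l := by field_simp; ring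
    _ ≤ 6 / l := by gcongr; nlinarith

/-- Van der Corput's inequality for exponential sums, with the shifted phases
`n ↦ f (n + h) - f n`. -/
theorem norm_expSum_sq_le (f : ℕ → ℝ) {N H : ℕ} (hH : 0 < H) (hHN : H ≤ N) :
    ‖expSum f N‖ ^ 2 ≤ 2 * (N : ℝ) ^ 2 / H +
      4 * N * ((∑ h ∈ Ico 1 H, ‖expSum (fwdDiff h f) (N - h)‖) / H) := by
  have h := van_der_corput_inequality (fun n => Complex.exp (f n * Complex.I)) N H hH
  have hH' : (0 : ℝ) < H := by exact_mod_cast hH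
  have hHN' : (H : ℝ) ≤ N := by exact_mod_cast hHN
  have hexp : ∀ x y : ℝ, Complex.exp (x * Complex.I) *
      (starRingEnd ℂ) (Complex.exp (y * Complex.I)) = Complex.exp ((x - y : ℝ) * Complex.I) := by
    intro x y
    rw [← Complex.exp_conj, ← Complex.exp_add]
    congr 1
    simp
    ring
  simp only [hexp] at h
  have h0 : ‖∑ n ∈ range N, Complex.exp ((f n - f n : ℝ) * Complex.I)‖ = N := by simp
  rw [h0] at h
  have hS : 0 ≤ ∑ h ∈ Ico 1 H, ‖expSum (fwdDiff h f) (N - h)‖ := sum_nonneg fun _ _ => norm_nonneg _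
  have hh : ∀ h, ∑ n ∈ range (N - h), Complex.exp ((f (n + h) - f n : ℝ) * Complex.I) =
    expSum (fwdDiff h f) (N - h) := fun h => rfl
  simp only [hh] at h
  rw [← expSum] at h
  generalize ∑ h ∈ Ico 1 H, ‖expSum (fwdDiff h f) (N - h)‖ = S at h hS ⊢
  have h2 : ‖expSum f N‖ ^ 2 ≤ (N + H) * (N + 2 * S) / H := by
    rw [le_div_iff₀ hH']; linarith
  refine h2.trans ?_
  calc _ ≤ (N + N) * (N + 2 * S) / H := by gcongr
    _ = _ := by field_simp; ring

lemma fwdDiff_iterate_fwdDiff (f : ℕ → ℝ) (k h n : ℕ) :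
    (fwdDiff 1)^[k] (fwdDiff h f) n = ∑ j ∈ range h, (fwdDiff 1)^[k + 1] f (n + j) := by
  have hc : Function.Commute (fwdDiff 1 : (ℕ → ℝ) → ℕ → ℝ) (fwdDiff h) := by
    intro f
    funext n
    simp only [fwdDiff]
    rw [add_right_comm]
    ring
  rw [(hc.iterate_left k).eq, Function.iterate_succ_apply']
  simp only [fwdDiff]
  have := Finset.sum_range_sub (fun j => (fwdDiff 1)^[k] f (n + j)) h
  simp only [add_zero] at this
  rw [← this]
  rfl

/-- The phase `f` has `k`-th differences in `[l, C l]` and nonpositive `(k+1)`-st differences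
on `[0, N)`. -/
def DiffBounds (k : ℕ) (f : ℕ → ℝ) (N : ℕ) (l C : ℝ) : Prop :=
  ∀ n < N, l ≤ (fwdDiff 1)^[k] f n ∧ (fwdDiff 1)^[k] f n ≤ C * l ∧ (fwdDiff 1)^[k + 1] f n ≤ 0

lemma DiffBounds.fwdDiff {k : ℕ} {f : ℕ → ℝ} {N : ℕ} {l C : ℝ} (hf : DiffBounds (k + 1) f N l C)
    (h : ℕ) : DiffBounds k (fwdDiff h f) (N - h) (h * l) C := by
  intro n hn
  have hj : ∀ j ∈ range h, n + j < N := fun j hj => by have := mem_range.1 hj; omega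
  refine ⟨?_, ?_, ?_⟩
  · rw [fwdDiff_iterate_fwdDiff]
    simpa using Finset.card_nsmul_le_sum (range h) _ l fun j hj' => (hf _ (hj j hj')).1
  · rw [fwdDiff_iterate_fwdDiff]
    have := Finset.sum_le_card_nsmul (range h) _ (C * l) fun j hj' => (hf _ (hj j hj')).2.1
    rw [card_range, nsmul_eq_mul] at this
    linarith
  · rw [fwdDiff_iterate_fwdDiff]
    exact Finset.sum_nonpos fun j hj' => (hf _ (hj j hj')).2.2

/-- A `k`-th difference test: exponential sums of length `N` with `k`-th differences of size `l`
are `≪ N l^a + L (N^b + N^c l^(-a))`, with `L` a logarithmic factor. -/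
def DiffTest (k : ℕ) (a b c : ℝ) : Prop :=
  ∀ C : ℝ, 1 ≤ C → ∃ K : ℝ, 1 ≤ K ∧ ∀ (f : ℕ → ℝ) (N : ℕ) (l L : ℝ), 1 ≤ N → 0 < l → 1 ≤ L →
    1 + Real.log N ≤ L → DiffBounds k f N l C →
    ‖expSum f N‖ ≤ K * (N * l ^ a + L * ((N : ℝ) ^ b + (N : ℝ) ^ c * l ^ (-a)))

private lemma sum_Ico_inv_le (H : ℕ) :
    ∑ h ∈ Ico 1 H, (1 / h : ℝ) ≤ 1 + Real.log H := by
  have h1 := harmonic_le_one_add_log H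
  rw [harmonic_eq_sum_Icc] at h1
  push_cast at h1
  refine le_trans ?_ h1
  simp only [one_div]
  refine Finset.sum_le_sum_of_subset_of_nonneg (fun x hx => ?_) (fun _ _ _ => by positivity)
  simp only [mem_Ico, mem_Icc] at hx ⊢
  omega

theorem diffTest_two : DiffTest 2 (1 / 2) (1 / 2) 0 := by
  intro C hC
  refine ⟨96 * C, by linarith, fun f N l L hN hl hL hlog hf => ?_⟩
  have hN' : (1 : ℝ) ≤ N := by exact_mod_cast hN
  have hp : 0 < l ^ (1 / 2 : ℝ) := by positivity
  have hp2 : (l ^ (1 / 2 : ℝ)) ^ 2 = l := by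
    rw [← Real.rpow_natCast, ← Real.rpow_mul hl.le]; norm_num
  have hq : 0 < (N : ℝ) ^ (1 / 2 : ℝ) := by positivity
  have hq2 : ((N : ℝ) ^ (1 / 2 : ℝ)) ^ 2 = N := by
    rw [← Real.rpow_natCast, ← Real.rpow_mul (by positivity)]; norm_num
  rw [Real.rpow_zero, one_mul, Real.rpow_neg hl.le]
  set p := l ^ (1 / 2 : ℝ)
  set q := (N : ℝ) ^ (1 / 2 : ℝ)
  rcases lt_or_ge 1 (C * l) with hCl | hCl
  · refine (norm_expSum_le f N).trans ?_
    have h1 : 1 ≤ C * p := by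
      have : 1 ≤ (C * p) ^ 2 := by
        rw [mul_pow, hp2, sq, mul_assoc]
        nlinarith
      nlinarith [mul_pos (by linarith : 0 < C) hp]
    have h2 : (N : ℝ) ≤ C * (N * p) := by nlinarith
    have h3 : 0 ≤ L * (q + p⁻¹) := by positivity
    have h4 : 0 ≤ N * p := by positivity
    nlinarith
  · have hx : 1 ≤ 1 / (C * l) := by
      rw [le_div_iff₀ (by positivity)]; linarith
    set H := min N ⌊1 / (C * l)⌋₊ with hHdef
    have hfl : 1 ≤ ⌊1 / (C * l)⌋₊ := Nat.one_le_floor_iff _ |>.2 hx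
    have hH : 1 ≤ H := le_min hN hfl
    have hHN : H ≤ N := min_le_left _ _
    have hH' : (1 : ℝ) ≤ H := by exact_mod_cast hH
    have hHx : (H : ℝ) ≤ 1 / (C * l) :=
      (Nat.cast_le.2 (min_le_right _ _)).trans (Nat.floor_le (by positivity))
    have hNH : (N : ℝ) / H ≤ 1 + 2 * C * N * l := by
      have h0 : 0 ≤ 2 * C * N * l := by positivity
      rcases le_total N ⌊1 / (C * l)⌋₊ with h | h
      · rw [hHdef, min_eq_left h, div_self (by positivity)]
        linarith
      · rw [hHdef, min_eq_right h]
        have h1 : 1 / (C * l) < ⌊1 / (C * l)⌋₊ + 1 := Nat.lt_floor_add_one _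
        have h2 : (1 : ℝ) ≤ ⌊1 / (C * l)⌋₊ := by exact_mod_cast hfl
        rw [div_le_iff₀ (by positivity)]
        rw [div_lt_iff₀ (by positivity)] at h1
        have h3 : 1 ≤ 2 * C * l * ⌊1 / (C * l)⌋₊ := by
          have : 0 < C * l := by positivity
          nlinarith
        nlinarith
    have hS : ∑ h ∈ Ico 1 H, ‖expSum (fwdDiff h f) (N - h)‖ ≤ 6 * L / l := by
      calc _ ≤ ∑ h ∈ Ico 1 H, 6 / l * (1 / h : ℝ) := by
            refine sum_le_sum fun h hh => ?_
            simp only [mem_Ico] at hh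
            have hh1 : (1 : ℝ) ≤ h := by exact_mod_cast hh.1
            have hhH : (h : ℝ) ≤ H := by exact_mod_cast hh.2.le
            have hb := DiffBounds.fwdDiff hf h
            refine (kusmin_landau (l := h * l) _ _ (by positivity) (fun n hn => (hb n hn).1)
              (fun n hn => (hb n hn).2.1.trans ?_) (fun n hn => ?_)).trans ?_
            · have h1 : (h : ℝ) * (C * l) ≤ 1 := by
                rw [← le_div_iff₀ (by positivity)]; exact hhH.trans hHx
              have := Real.pi_gt_three
              linarith
            · exact sub_nonpos.1 (hb n (by omega)).2.2
            · apply le_of_eq; field_simp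
        _ = 6 / l * ∑ h ∈ Ico 1 H, (1 / h : ℝ) := by rw [mul_sum]
        _ ≤ 6 / l * L := by
            gcongr
            refine (sum_Ico_inv_le H).trans (le_trans ?_ hlog)
            gcongr
        _ = _ := by ring
    have hmain := norm_expSum_sq_le f hH hHN
    have h1 : ‖expSum f N‖ ^ 2 ≤ (1 + 2 * C * N * l) * (2 * N + 24 * L / l) := by
      calc _ ≤ 2 * (N : ℝ) ^ 2 / H + 4 * N * ((6 * L / l) / H) := hmain.trans (by gcongr)
        _ = N / H * (2 * N + 24 * L / l) := by ring
        _ ≤ _ := by gcongr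
    have h2 : (1 + 2 * C * N * l) * (2 * N + 24 * L / l) ≤
        96 * C * (N ^ 2 * l + L ^ 2 * N + L ^ 2 / l) := by
      have e1 : (1 + 2 * C * N * l) * (2 * N + 24 * L / l) =
          2 * N + 24 * (L / l) + 4 * C * (N ^ 2 * l) + 48 * C * (N * L) := by
        field_simp; ring
      rw [e1]
      have e2 : L / l ≤ L ^ 2 / l := by gcongr; nlinarith
      have e3 : N * L ≤ L ^ 2 * (N : ℝ) := by nlinarith [mul_nonneg (by linarith : (0:ℝ) ≤ N) (by linarith : 0 ≤ L)]
      have e4 : (N : ℝ) ≤ L ^ 2 * (N : ℝ) := by nlinarith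
      have e5 : 0 ≤ N ^ 2 * l := by positivity
      have e6 : 0 ≤ L ^ 2 / l := by positivity
      have e7 : 0 ≤ L ^ 2 * (N : ℝ) := by positivity
      have e8 : 48 * C * (N * L) ≤ 48 * C * (L ^ 2 * (N : ℝ)) := by gcongr
      nlinarith [mul_le_mul_of_nonneg_right hC e6, mul_le_mul_of_nonneg_right hC e7,
        mul_le_mul_of_nonneg_right hC e5]
    have h3 : N ^ 2 * l + L ^ 2 * N + L ^ 2 / l ≤ (N * p + L * (q + p⁻¹)) ^ 2 := by
      have e1 : (N * p + L * (q + p⁻¹)) ^ 2 = N ^ 2 * p ^ 2 + L ^ 2 * q ^ 2 + L ^ 2 / p ^ 2 +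
        (2 * N * p * L * (q + p⁻¹) + 2 * L ^ 2 * q * p⁻¹) := by field_simp; ring
      rw [e1, hp2, hq2]
      have : 0 ≤ 2 * N * p * L * (q + p⁻¹) + 2 * L ^ 2 * q * p⁻¹ := by positivity
      linarith
    rw [← sq_le_sq₀ (norm_nonneg _) (by positivity), mul_pow]
    calc _ ≤ 96 * C * (N * p + L * (q + p⁻¹)) ^ 2 := h1.trans (h2.trans (by gcongr))
      _ ≤ _ := by gcongr; exact le_self_pow₀ (by linarith) two_ne_zero

private lemma sum_Ico_rpow_neg_le {a : ℝ} (ha0 : 0 ≤ a) (ha : a ≤ 1 / 2) (H : ℕ) :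
    ∑ h ∈ Ico 1 (H + 1), (h : ℝ) ^ (-a) ≤ 2 * (H : ℝ) ^ (1 - a) := by
  induction H with
  | zero => simp; positivity
  | succ H ih =>
    rw [Finset.sum_Ico_succ_top (by omega)]
    have hb := rpow_one_add_le_one_add_mul_self (s := -(1 / (H + 1 : ℝ))) (p := 1 - a)
      (by rw [neg_le_neg_iff, div_le_one (by positivity)]; linarith [Nat.cast_nonneg (α := ℝ) H])
      (by linarith) (by linarith)
    have h0 : (0 : ℝ) < H + 1 := by positivity
    have h1 : (1 + -(1 / (H + 1 : ℝ))) = H / (H + 1) := by field_simp; ring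
    rw [h1, Real.div_rpow (by positivity) (by positivity), div_le_iff₀ (by positivity)] at hb
    have h2 : (H + 1 : ℝ) ^ (1 - a) = (H + 1) * (H + 1 : ℝ) ^ (-a) := by
      rw [sub_eq_add_neg, Real.rpow_add h0, Real.rpow_one]
    push_cast
    have h3 : (1 + (1 - a) * -(1 / (H + 1 : ℝ))) * (H + 1 : ℝ) ^ (1 - a) =
        (H + 1 : ℝ) ^ (1 - a) - (1 - a) * (H + 1 : ℝ) ^ (-a) := by
      rw [h2]; field_simp; ring
    rw [h3] at hb
    have h4 : 0 ≤ (H + 1 : ℝ) ^ (-a) := by positivity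
    nlinarith

/-- One step of Weyl–van der Corput differencing. -/
theorem DiffTest.succ {k : ℕ} {a b c : ℝ} (ha0 : 0 < a) (ha : a ≤ 1 / 2) (hb : 0 ≤ b) (hc : 0 ≤ c)
    (ht : DiffTest k a b c) :
    DiffTest (k + 1) (a / (2 * (a + 1))) ((1 + b) / 2) ((1 + c) / 2) := by
  intro C hC
  obtain ⟨K, hK, hKb⟩ := ht C hC
  refine ⟨4 + 16 * K, by linarith, fun f N l L hN hl hL hlog hf => ?_⟩
  have hN' : (1 : ℝ) ≤ N := by exact_mod_cast hN
  have hN0 : (0 : ℝ) < N := by linarith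
  set d := a / (2 * (a + 1)) with hd
  have hd0 : 0 < d := by positivity
  have hlogN : 0 ≤ Real.log N := Real.log_nonneg hN'
  have hp2 : (l ^ d) ^ 2 = l ^ (2 * d) := by
    rw [← Real.rpow_natCast, ← Real.rpow_mul hl.le, mul_comm]; norm_num
  have hr2 : (l ^ (-d)) ^ 2 = l ^ (-(2 * d)) := by
    rw [← Real.rpow_natCast, ← Real.rpow_mul hl.le]; congr 1; push_cast; ring
  have hq2 : ∀ x : ℝ, ((N : ℝ) ^ ((1 + x) / 2)) ^ 2 = N * (N : ℝ) ^ x := by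
    intro x
    have h : (N : ℝ) * (N : ℝ) ^ x = (N : ℝ) ^ (1 + x) := by
      rw [Real.rpow_add hN0, Real.rpow_one]
    rw [← Real.rpow_natCast, ← Real.rpow_mul hN0.le, h]
    congr 1; push_cast; ring
  have hYsq : N ^ 2 * l ^ (2 * d) + L ^ 2 * (N * (N : ℝ) ^ b) +
      L ^ 2 * (N * (N : ℝ) ^ c * l ^ (-(2 * d))) ≤
      (N * l ^ d + L * ((N : ℝ) ^ ((1 + b) / 2) + (N : ℝ) ^ ((1 + c) / 2) * l ^ (-d))) ^ 2 := by
    rw [← hp2, ← hr2, ← hq2, ← hq2]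
    have h1 : 0 < l ^ d := by positivity
    have h2 : 0 < l ^ (-d) := by positivity
    have h3 : 0 < (N : ℝ) ^ ((1 + b) / 2) := by positivity
    have h4 : 0 < (N : ℝ) ^ ((1 + c) / 2) := by positivity
    generalize l ^ d = p at *
    generalize l ^ (-d) = r at *
    generalize (N : ℝ) ^ ((1 + b) / 2) = q at *
    generalize (N : ℝ) ^ ((1 + c) / 2) = s at *
    have : 0 ≤ 2 * (N * p * L * q + N * p * L * s * r + L ^ 2 * q * s * r) := by positivity
    linarith
  have hY0 : 0 ≤ N * l ^ d + L * ((N : ℝ) ^ ((1 + b) / 2) + (N : ℝ) ^ ((1 + c) / 2) * l ^ (-d)) := by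
    positivity
  generalize N * l ^ d + L * ((N : ℝ) ^ ((1 + b) / 2) + (N : ℝ) ^ ((1 + c) / 2) * l ^ (-d)) = Y at *
  have hX1 : 0 ≤ N ^ 2 * l ^ (2 * d) := by positivity
  have hX2 : 0 ≤ L ^ 2 * (N * (N : ℝ) ^ b) := by positivity
  have hX3 : 0 ≤ L ^ 2 * (N * (N : ℝ) ^ c * l ^ (-(2 * d))) := by positivity
  have hbN : (1 : ℝ) ≤ (N : ℝ) ^ b := Real.one_le_rpow hN' hb
  have hcN : (1 : ℝ) ≤ (N : ℝ) ^ c := Real.one_le_rpow hN' hc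
  have hL2 : L ≤ L ^ 2 := by nlinarith
  suffices h : ‖expSum f N‖ ^ 2 ≤ (4 + 16 * K) * (N ^ 2 * l ^ (2 * d) + L ^ 2 * (N * (N : ℝ) ^ b) +
      L ^ 2 * (N * (N : ℝ) ^ c * l ^ (-(2 * d)))) by
    rw [← sq_le_sq₀ (norm_nonneg _) (by positivity), mul_pow]
    calc _ ≤ (4 + 16 * K) * Y ^ 2 := h.trans (by gcongr)
      _ ≤ _ := by gcongr; exact le_self_pow₀ (by linarith) two_ne_zero
  have htriv : ‖expSum f N‖ ^ 2 ≤ (N : ℝ) ^ 2 := by gcongr; exact norm_expSum_le f N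
  rcases lt_or_ge 1 l with hl1 | hl1
  · have h1 : 1 ≤ l ^ (2 * d) := Real.one_le_rpow hl1.le (by positivity)
    have h2 : (N : ℝ) ^ 2 ≤ N ^ 2 * l ^ (2 * d) := by nlinarith
    nlinarith
  have hH01 : 1 ≤ l ^ (-(2 * d)) := Real.one_le_rpow_of_pos_of_le_one_of_nonpos hl hl1 (by linarith)
  rcases le_or_gt (N : ℝ) (l ^ (-(2 * d))) with hNH | hNH
  · have h2 : (N : ℝ) ^ 2 ≤ L ^ 2 * (N * (N : ℝ) ^ c * l ^ (-(2 * d))) := by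
      calc (N : ℝ) ^ 2 = 1 * (N * 1 * N) := by ring
        _ ≤ _ := by gcongr; nlinarith
    nlinarith
  set H0 := l ^ (-(2 * d)) with hH0
  set H := ⌊H0⌋₊ with hHdef
  have hH : 1 ≤ H := Nat.one_le_floor_iff _ |>.2 hH01
  have hH' : (1 : ℝ) ≤ H := by exact_mod_cast hH
  have hHle : (H : ℝ) ≤ H0 := Nat.floor_le (by positivity)
  have hHN : H ≤ N := by exact_mod_cast hHle.trans hNH.le
  have hH2 : H0 / 2 ≤ H := by
    have : H0 < H + 1 := Nat.lt_floor_add_one _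
    linarith
  have hexp : (1 - 2 * d) * a = 2 * d := by rw [hd]; field_simp; ring
  have hup : (H0 * l) ^ a = l ^ (2 * d) := by
    rw [hH0, ← Real.rpow_add_one hl.ne', ← Real.rpow_mul hl.le]
    congr 1; linarith
  have hdown : H0 ^ (-a) * l ^ (-a) = H0 := by
    rw [← Real.mul_rpow (by positivity) hl.le, Real.rpow_neg (by positivity), hup, hH0,
      Real.rpow_neg hl.le]
  have hsum : (∑ h ∈ Ico 1 H, ‖expSum (fwdDiff h f) (N - h)‖) / H ≤
      K * (N * l ^ (2 * d) + L * ((N : ℝ) ^ b + 4 * (N : ℝ) ^ c * H0)) := by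
    rw [div_le_iff₀ (by linarith)]
    calc _ ≤ ∑ h ∈ Ico 1 H, (K * (N * l ^ (2 * d) + L * (N : ℝ) ^ b) +
          K * L * (N : ℝ) ^ c * l ^ (-a) * (h : ℝ) ^ (-a)) := by
          refine sum_le_sum fun h hh => ?_
          simp only [mem_Ico] at hh
          have hh1 : (1 : ℝ) ≤ h := by exact_mod_cast hh.1
          have hhH : (h : ℝ) ≤ H := by exact_mod_cast hh.2.le
          have hNh : ((N - h : ℕ) : ℝ) ≤ N := by exact_mod_cast Nat.sub_le _ _
          have hNh1 : 1 ≤ N - h := by omega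
          have hNh0 : (0 : ℝ) < (N - h : ℕ) := by exact_mod_cast hNh1
          have hlog' : 1 + Real.log (N - h : ℕ) ≤ L := le_trans (by gcongr) hlog
          refine (hKb _ _ (h * l) L hNh1 (by positivity) hL hlog' (DiffBounds.fwdDiff hf h)).trans ?_
          rw [Real.mul_rpow (y := l) (z := -a) (by positivity) hl.le]
          calc _ ≤ K * (N * l ^ (2 * d) + L * ((N : ℝ) ^ b + (N : ℝ) ^ c *
                ((h : ℝ) ^ (-a) * l ^ (-a)))) := by
                rw [← hup]
                gcongr
                exact hhH.trans hHle
            _ = _ := by ring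
      _ ≤ H * (K * (N * l ^ (2 * d) + L * (N : ℝ) ^ b)) +
          K * L * (N : ℝ) ^ c * l ^ (-a) * (2 * (H : ℝ) ^ (1 - a)) := by
          rw [sum_add_distrib, sum_const, nsmul_eq_mul, Nat.card_Ico, ← mul_sum]
          gcongr
          · exact_mod_cast Nat.sub_le _ _
          · refine le_trans ?_ (sum_Ico_rpow_neg_le ha0.le ha H)
            exact Finset.sum_le_sum_of_subset_of_nonneg (Finset.Ico_subset_Ico le_rfl (by omega))
              (fun _ _ _ => by positivity)
      _ ≤ H * (K * (N * l ^ (2 * d) + L * (N : ℝ) ^ b)) +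
          K * L * (N : ℝ) ^ c * (H * (4 * H0)) := by
          have h1 : (H : ℝ) ^ (-a) ≤ 2 * H0 ^ (-a) := by
            calc (H : ℝ) ^ (-a) ≤ (H0 / 2) ^ (-a) :=
                  Real.rpow_le_rpow_of_nonpos (by positivity) hH2 (by linarith)
              _ = 2 ^ a * H0 ^ (-a) := by
                  rw [Real.div_rpow (by positivity) (by positivity), Real.rpow_neg zero_le_two]
                  field_simp
              _ ≤ _ := by
                  gcongr
                  calc (2 : ℝ) ^ a ≤ 2 ^ (1 : ℝ) :=
                        Real.rpow_le_rpow_of_exponent_le one_le_two (by linarith)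
                    _ = 2 := Real.rpow_one 2
          have h2 : l ^ (-a) * (2 * (H : ℝ) ^ (1 - a)) ≤ H * (4 * H0) := by
            rw [sub_eq_add_neg, Real.rpow_add (by linarith), Real.rpow_one]
            calc _ = H * (2 * l ^ (-a)) * (H : ℝ) ^ (-a) := by ring
              _ ≤ H * (2 * l ^ (-a)) * (2 * H0 ^ (-a)) := by gcongr
              _ = H * (4 * (H0 ^ (-a) * l ^ (-a))) := by ring
              _ = _ := by rw [hdown]
          rw [mul_assoc _ (l ^ (-a))]
          gcongr
      _ = _ := by ring
  have hfirst : 2 * (N : ℝ) ^ 2 / H ≤ 4 * (N ^ 2 * l ^ (2 * d)) := by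
    have h1 : l ^ (2 * d) * H0 = 1 := by rw [hH0, ← Real.rpow_add hl]; simp
    rw [div_le_iff₀ (by linarith)]
    have h3 : 0 ≤ 4 * (N ^ 2 * l ^ (2 * d)) := by positivity
    calc 2 * (N : ℝ) ^ 2 = 4 * (N ^ 2 * l ^ (2 * d)) * (H0 / 2) := by
          linear_combination (-2 * (N : ℝ) ^ 2) * h1
      _ ≤ _ := by gcongr
  calc ‖expSum f N‖ ^ 2 ≤ 4 * (N ^ 2 * l ^ (2 * d)) +
        4 * N * (K * (N * l ^ (2 * d) + L * ((N : ℝ) ^ b + 4 * (N : ℝ) ^ c * H0))) :=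
        (norm_expSum_sq_le f hH hHN).trans (by gcongr)
    _ = (4 + 4 * K) * (N ^ 2 * l ^ (2 * d)) + 4 * K * (L * (N * (N : ℝ) ^ b)) +
        16 * K * (L * (N * (N : ℝ) ^ c * H0)) := by ring
    _ ≤ (4 + 16 * K) * (N ^ 2 * l ^ (2 * d)) + (4 + 16 * K) * (L ^ 2 * (N * (N : ℝ) ^ b)) +
        (4 + 16 * K) * (L ^ 2 * (N * (N : ℝ) ^ c * H0)) := by gcongr <;> linarith
    _ = _ := by ring

theorem diffTest_three : DiffTest 3 (1 / 6) (3 / 4) (1 / 2) := by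
  convert diffTest_two.succ (by norm_num) le_rfl (by norm_num) le_rfl using 1 <;> norm_num

theorem diffTest_four : DiffTest 4 (1 / 14) (7 / 8) (3 / 4) := by
  convert diffTest_three.succ (by norm_num) (by norm_num) (by norm_num) (by norm_num) using 1 <;>
    norm_num

private lemma hasDerivAt_fwdDiff_iterate {φ : ℕ → ℝ → ℝ}
    (hφ : ∀ i x, 0 < x → HasDerivAt (φ i) (φ (i + 1) x) x) (k : ℕ) :
    ∀ (i : ℕ) (x : ℝ), 0 < x → HasDerivAt ((fwdDiff 1)^[k] (φ i)) ((fwdDiff 1)^[k] (φ (i + 1)) x) x := by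
  induction k with
  | zero => exact hφ
  | succ k ih =>
    intro i x hx
    simp only [Function.iterate_succ_apply']
    exact ((ih i (x + 1) (by linarith)).comp_add_const x 1).sub (ih i x hx)

/-- Mean value theorem for iterated forward differences. -/
lemma exists_fwdDiff_iterate_eq {φ : ℕ → ℝ → ℝ}
    (hφ : ∀ i x, 0 < x → HasDerivAt (φ i) (φ (i + 1) x) x) (k : ℕ) :
    ∀ (i : ℕ) (x : ℝ), 0 < x → ∃ ξ : ℝ, x ≤ ξ ∧ ξ ≤ x + k ∧ (fwdDiff 1)^[k] (φ i) x = φ (i + k) ξ := by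
  induction k with
  | zero => exact fun i x _ => ⟨x, le_rfl, by simp, rfl⟩
  | succ k ih =>
    intro i x hx
    obtain ⟨η, hη, h⟩ := exists_hasDerivAt_eq_slope ((fwdDiff 1)^[k] (φ i))
      ((fwdDiff 1)^[k] (φ (i + 1))) (by linarith : x < x + 1)
      (fun y hy => (hasDerivAt_fwdDiff_iterate hφ k i y
        (by linarith [hy.1])).continuousAt.continuousWithinAt)
      (fun y hy => hasDerivAt_fwdDiff_iterate hφ k i y (by linarith [hy.1]))
    obtain ⟨ξ, h1, h2, h3⟩ := ih (i + 1) η (by linarith [hη.1])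
    refine ⟨ξ, by linarith [hη.1], by push_cast; linarith [hη.2], ?_⟩
    rw [h3, add_sub_cancel_left, div_one] at h
    rw [Function.iterate_succ_apply', fwdDiff, ← h]
    congr 1; ring

lemma exists_fwdDiff_iterate_log_eq (j : ℕ) {x : ℝ} (hx : 0 < x) :
    ∃ ξ : ℝ, x ≤ ξ ∧ ξ ≤ x + (j + 1 : ℕ) ∧
      (fwdDiff 1)^[j + 1] Real.log x = (-1) ^ j * j.factorial / ξ ^ (j + 1) := by
  set φ : ℕ → ℝ → ℝ := fun i => Nat.casesOn i Real.log
    (fun i x => (-1) ^ i * i.factorial / x ^ (i + 1)) with hφ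
  have h : ∀ i x, 0 < x → HasDerivAt (φ i) (φ (i + 1) x) x := by
    rintro (_ | i) x hx
    · simpa [hφ] using Real.hasDerivAt_log hx.ne'
    · simp only [hφ]
      have h1 := ((hasDerivAt_pow (i + 1) x).inv (by positivity)).const_mul
        ((-1) ^ i * i.factorial : ℝ)
      refine HasDerivAt.congr_deriv (f' := _) (h1.congr_of_eventuallyEq ?_) ?_
      · exact Filter.Eventually.of_forall fun y => by simp [div_eq_mul_inv]
      · rw [Nat.factorial_succ]
        push_cast
        field_simp
        ring
  obtain ⟨ξ, h1, h2, h3⟩ := exists_fwdDiff_iterate_eq h (j + 1) 0 x hx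
  refine ⟨ξ, h1, h2, ?_⟩
  rw [zero_add] at h3
  exact h3

private lemma fwdDiff_iterate_comp (c y : ℝ) (φ : ℝ → ℝ) (k n : ℕ) :
    (fwdDiff 1)^[k] (fun n : ℕ => c * φ (y + n)) n = c * (fwdDiff 1)^[k] φ (y + n) := by
  induction k generalizing n with
  | zero => rfl
  | succ k ih =>
    simp only [Function.iterate_succ_apply', fwdDiff, ih]
    push_cast
    rw [add_assoc, mul_sub]

lemma norm_expSum_neg (f : ℕ → ℝ) (N : ℕ) : ‖expSum (fun n => -f n) N‖ = ‖expSum f N‖ := by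
  rw [← Complex.norm_conj, expSum, expSum, map_sum]
  congr 1
  refine sum_congr rfl fun n _ => ?_
  rw [← Complex.exp_conj]
  simp

/-- The phase of the block `[M, M + N)` of the Dirichlet series `∑ (m + α)^(-σ - i τ)`. -/
noncomputable def logPhase (τ α : ℝ) (M : ℕ) (n : ℕ) : ℝ := τ * Real.log (M + α + n)

lemma norm_expSum_signed_logPhase (τ α : ℝ) (M N j : ℕ) :
    ‖expSum (fun n => ((-1) ^ j * τ) * Real.log (M + α + n)) N‖ = ‖expSum (logPhase τ α M) N‖ := by
  rcases neg_one_pow_eq_or ℝ j with h | h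
  · simp only [h, one_mul]; rfl
  · simp only [h, neg_mul, one_mul]
    exact norm_expSum_neg (logPhase τ α M) N

lemma diffBounds_logPhase {τ α : ℝ} (hτ : 0 < τ) (hα : α ∈ Set.Icc (0 : ℝ) 1) {M N : ℕ}
    (hM : 1 ≤ M) (hNM : N ≤ M) (j : ℕ) :
    DiffBounds (j + 1) (fun n => ((-1) ^ j * τ) * Real.log (M + α + n)) N
      (j.factorial / (j + 4) ^ (j + 1) * (τ / M ^ (j + 1))) ((j + 4) ^ (j + 1)) := by
  intro n hn
  have hM' : (1 : ℝ) ≤ M := by exact_mod_cast hM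
  have hn' : (n : ℝ) + 1 ≤ M := by exact_mod_cast (by omega : n + 1 ≤ M)
  have hn0 : (0 : ℝ) ≤ n := by positivity
  have hx : 0 < M + α + n := by linarith [hα.1]
  have hsq : ∀ i : ℕ, ((-1 : ℝ) ^ i) * (-1) ^ i = 1 := fun i => by
    rw [← mul_pow]; simp
  rw [fwdDiff_iterate_comp, fwdDiff_iterate_comp]
  obtain ⟨ξ, h1, h2, h3⟩ := exists_fwdDiff_iterate_log_eq j hx
  have e1 : (-1) ^ j * τ * (fwdDiff 1)^[j + 1] Real.log (M + α + n) =
      τ * j.factorial / ξ ^ (j + 1) := by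
    rw [h3]; linear_combination (τ * j.factorial / ξ ^ (j + 1)) * hsq j
  have hMξ : (M : ℝ) ≤ ξ := by linarith [hα.1]
  have hξ : ξ ≤ (j + 4) * M := by
    push_cast at h2
    have := hα.2
    have : (j : ℝ) ≤ j * M := le_mul_of_one_le_right (by positivity) hM'
    linarith
  have hξ0 : 0 < ξ := by linarith
  refine ⟨?_, ?_, ?_⟩
  · rw [e1]
    calc _ = τ * j.factorial / ((j + 4) * M) ^ (j + 1) := by
          rw [mul_pow]; field_simp
      _ ≤ _ := by gcongr
  · rw [e1]
    calc _ ≤ τ * j.factorial / M ^ (j + 1) := by gcongr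
      _ = _ := by field_simp
  · obtain ⟨ζ, k1, k2, k3⟩ := exists_fwdDiff_iterate_log_eq (j + 1) hx
    have hζ : 0 < ζ := by linarith
    have e2 : (-1) ^ j * τ * (fwdDiff 1)^[j + 1 + 1] Real.log (M + α + n) =
        -(τ * (j + 1).factorial / ζ ^ (j + 1 + 1)) := by
      rw [k3, pow_succ (-1 : ℝ)]
      linear_combination (-(τ * (j + 1).factorial / ζ ^ (j + 1 + 1))) * hsq j
    rw [e2, neg_nonpos]
    positivity

/-- First derivative bound for blocks beyond the conductor. -/
lemma norm_expSum_logPhase_le_div {τ α : ℝ} (hτ : 0 < τ) (hα : α ∈ Set.Icc (0 : ℝ) 1) {M N : ℕ}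
    (hM : 1 ≤ M) (hNM : N ≤ M) (hτM : τ ≤ M) :
    ‖expSum (logPhase τ α M) N‖ ≤ 24 * (M / τ) := by
  have hM' : (1 : ℝ) ≤ M := by exact_mod_cast hM
  have hb := diffBounds_logPhase hτ hα hM hNM 0
  rw [← norm_expSum_signed_logPhase τ α M N 0]
  refine (kusmin_landau _ N (l := τ / (4 * M)) (by positivity) (fun n hn => ?_) (fun n hn => ?_)
    (fun n hn => ?_)).trans ?_
  · refine le_trans (le_of_eq ?_) (hb n hn).1
    simp; field_simp
  · refine (hb n hn).2.1.trans ?_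
    have : τ / M ≤ 1 := by rw [div_le_one (by positivity)]; exact hτM
    simp
    linarith [Real.pi_gt_three]
  · exact sub_nonpos.1 (hb n (by omega)).2.2
  · apply le_of_eq; field_simp; norm_num

lemma DiffTest.norm_expSum_logPhase_le {j : ℕ} {a b c : ℝ} (hb : 0 ≤ b) (hc : 0 ≤ c)
    (ht : DiffTest (j + 1) a b c) :
    ∃ K : ℝ, 0 ≤ K ∧ ∀ (τ α : ℝ) (M N : ℕ), 0 < τ → α ∈ Set.Icc (0 : ℝ) 1 → 1 ≤ M → N ≤ M →
      ‖expSum (logPhase τ α M) N‖ ≤ K * ((1 + Real.log M) *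
        (M * (τ / M ^ (j + 1)) ^ a + (M : ℝ) ^ b + (M : ℝ) ^ c * (τ / M ^ (j + 1)) ^ (-a))) := by
  obtain ⟨K, hK, h⟩ := ht ((j + 4) ^ (j + 1)) (one_le_pow₀ (by linarith [Nat.cast_nonneg (α := ℝ) j]))
  set κ : ℝ := j.factorial / (j + 4) ^ (j + 1) with hκ
  have hκ0 : 0 < κ := by positivity
  refine ⟨K * (κ ^ a + 1 + κ ^ (-a)), by positivity, fun τ α M N hτ hα hM hNM => ?_⟩
  have hM' : (1 : ℝ) ≤ M := by exact_mod_cast hM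
  have hlog : 0 ≤ Real.log M := Real.log_nonneg hM'
  rcases Nat.eq_zero_or_pos N with rfl | hN
  · simp only [expSum, range_zero, sum_empty, norm_zero]; positivity
  have hN' : (1 : ℝ) ≤ N := by exact_mod_cast hN
  have hNM' : (N : ℝ) ≤ M := by exact_mod_cast hNM
  rw [← norm_expSum_signed_logPhase τ α M N j]
  refine (h _ N (κ * (τ / M ^ (j + 1))) (1 + Real.log M) hN (by positivity) (by linarith)
    (by gcongr) (diffBounds_logPhase hτ hα hM hNM j)).trans ?_
  rw [Real.mul_rpow hκ0.le (by positivity), Real.mul_rpow hκ0.le (by positivity), mul_assoc K]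
  have hq : 0 < τ / M ^ (j + 1) := by positivity
  have hL : 1 ≤ 1 + Real.log M := by linarith
  generalize τ / M ^ (j + 1) = q at *
  have h1 : (N : ℝ) ^ b ≤ (M : ℝ) ^ b := by gcongr
  have h2 : (N : ℝ) ^ c ≤ (M : ℝ) ^ c := by gcongr
  have p1 : 0 < κ ^ a := by positivity
  have p2 : 0 < κ ^ (-a) := by positivity
  have p3 : 0 < q ^ a := by positivity
  have p4 : 0 < q ^ (-a) := by positivity
  have p5 : 0 < (M : ℝ) ^ b := by positivity
  have p6 : 0 < (M : ℝ) ^ c := by positivity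
  generalize κ ^ a = A at *
  generalize κ ^ (-a) = B at *
  generalize q ^ a = Q at *
  generalize q ^ (-a) = R at *
  generalize (1 + Real.log M) = L at *
  refine mul_le_mul_of_nonneg_left ?_ (by linarith)
  have k1 : N * (A * Q) ≤ A * (L * (M * Q)) := by
    calc N * (A * Q) ≤ M * (A * Q) := by gcongr
      _ ≤ L * (M * (A * Q)) := le_mul_of_one_le_left (by positivity) hL
      _ = _ := by ring
  calc _ ≤ A * (L * (M * Q)) + L * ((M : ℝ) ^ b + (M : ℝ) ^ c * (B * R)) := by gcongr
    _ ≤ A * (L * (M * Q)) + L * ((M : ℝ) ^ b + (M : ℝ) ^ c * (B * R)) +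
        (A * (L * ((M : ℝ) ^ b + (M : ℝ) ^ c * R)) + L * (M * Q + (M : ℝ) ^ c * R) +
          B * (L * (M * Q + (M : ℝ) ^ b))) := le_add_of_nonneg_right (by positivity)
    _ = _ := by ring

/-- The convexity exponent interpolating the bounds at `σ = 1/2`, `σ = 5/7` and `σ = 1`. -/
noncomputable def subconvexExponent (σ : ℝ) : ℝ :=
  if σ ≤ 5 / 7 then 1 / 6 - 4 / 9 * (σ - 1 / 2) else if σ ≤ 1 then (1 - σ) / 4 else 0

lemma subconvexExponent_nonneg (σ : ℝ) : 0 ≤ subconvexExponent σ := by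
  unfold subconvexExponent
  split_ifs <;> linarith

private lemma exponent_cases {σ x y : ℝ} (hσ : 1 / 2 ≤ σ) (hx : 0 ≤ x) (hxy : x ≤ y) :
    (4 / 9 * y ≤ x ∧ x / 2 + y / 6 ≤ σ * x + subconvexExponent σ * y) ∨
    (x ≤ 4 / 9 * y ∧ 5 / 7 * x + y / 14 ≤ σ * x + subconvexExponent σ * y) ∨
    x ≤ σ * x + subconvexExponent σ * y := by
  rcases lt_or_ge 1 σ with h1 | h1
  · right; right
    have := mul_nonneg (subconvexExponent_nonneg σ) (hx.trans hxy)
    nlinarith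
  rcases le_total (4 / 9 * y) x with h | h
  · refine Or.inl ⟨h, ?_⟩
    unfold subconvexExponent
    split_ifs <;> nlinarith
  · rcases le_or_gt σ (5 / 7) with h2 | h2
    · refine Or.inr (Or.inl ⟨h, ?_⟩)
      rw [subconvexExponent, if_pos h2]
      nlinarith
    · rw [subconvexExponent, if_neg h2.not_ge, if_pos h1]
      rcases le_total x (y / 4) with h3 | h3
      · right; right; nlinarith
      · exact Or.inr (Or.inl ⟨h, by nlinarith⟩)

private lemma exp_terms_le {x y a b c E : ℝ} (j : ℕ)
    (h1 : x + (y - (j + 1) * x) * a ≤ E) (h2 : x * b ≤ E)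
    (h3 : x * c - (y - (j + 1) * x) * a ≤ E) :
    Real.exp x * (Real.exp y / Real.exp x ^ (j + 1)) ^ a + Real.exp x ^ b +
      Real.exp x ^ c * (Real.exp y / Real.exp x ^ (j + 1)) ^ (-a) ≤ 3 * Real.exp E := by
  rw [← Real.exp_nat_mul, ← Real.exp_sub, ← Real.exp_mul, ← Real.exp_mul, ← Real.exp_mul,
    ← Real.exp_mul, ← Real.exp_add, ← Real.exp_add]
  have k1 := Real.exp_le_exp.2 h1
  have k2 := Real.exp_le_exp.2 h2
  have k3 := Real.exp_le_exp.2 h3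
  push_cast
  rw [mul_neg, ← sub_eq_add_neg]
  linarith

/-- Bound for a block of `∑ (m + α)^(-i τ)` of length at most `2 τ ^ 2`. -/
lemma exists_norm_expSum_logPhase_le :
    ∃ K : ℝ, 0 ≤ K ∧ ∀ (σ τ α : ℝ) (M N : ℕ), 1 / 2 ≤ σ → 1 ≤ τ → α ∈ Set.Icc (0 : ℝ) 1 →
      1 ≤ M → N ≤ M → (M : ℝ) ≤ 2 * τ ^ 2 →
      ‖expSum (logPhase τ α M) N‖ ≤
        K * (1 + Real.log M) * ((M : ℝ) ^ σ * τ ^ subconvexExponent σ) := by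
  obtain ⟨K₂, hK₂, h₂⟩ := diffTest_two.norm_expSum_logPhase_le (j := 1) (by norm_num) (by norm_num)
  obtain ⟨K₃, hK₃, h₃⟩ := diffTest_three.norm_expSum_logPhase_le (j := 2) (by norm_num)
    (by norm_num)
  obtain ⟨K₄, hK₄, h₄⟩ := diffTest_four.norm_expSum_logPhase_le (j := 3) (by norm_num)
    (by norm_num)
  refine ⟨3 * (K₂ + K₃ + K₄) + 48, by positivity, fun σ τ α M N hσ hτ hα hM hNM hMτ => ?_⟩
  have hM' : (1 : ℝ) ≤ M := by exact_mod_cast hM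
  have hτ0 : 0 < τ := by linarith
  obtain ⟨x, hx⟩ : ∃ x, x = Real.log M := ⟨_, rfl⟩
  obtain ⟨y, hy⟩ : ∃ y, y = Real.log τ := ⟨_, rfl⟩
  have ex : (M : ℝ) = Real.exp x := by rw [hx, Real.exp_log (by linarith)]
  have ey : τ = Real.exp y := by rw [hy, Real.exp_log hτ0]
  have hx0 : 0 ≤ x := hx ▸ Real.log_nonneg hM'
  have hy0 : 0 ≤ y := hy ▸ Real.log_nonneg hτ
  rw [← hx]
  set E := σ * x + subconvexExponent σ * y with hE
  have hEe : (M : ℝ) ^ σ * τ ^ subconvexExponent σ = Real.exp E := by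
    rw [ex, ey, ← Real.exp_mul, ← Real.exp_mul, ← Real.exp_add, hE]; ring_nf
  rw [hEe]
  have key : ∀ {T k : ℝ}, 0 ≤ k → k ≤ K₂ + K₃ + K₄ → T ≤ 3 * Real.exp E →
      k * ((1 + x) * T) ≤ (3 * (K₂ + K₃ + K₄) + 48) * (1 + x) * Real.exp E := by
    intro T k hk hk' hT
    calc k * ((1 + x) * T) ≤ k * ((1 + x) * (3 * Real.exp E)) := by gcongr
      _ ≤ (K₂ + K₃ + K₄) * ((1 + x) * (3 * Real.exp E)) := by gcongr
      _ = 3 * (K₂ + K₃ + K₄) * (1 + x) * Real.exp E := by ring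
      _ ≤ _ := by gcongr; linarith
  rcases le_or_gt x y with hxy | hxy
  · rcases exponent_cases hσ hx0 hxy with ⟨h1, h2⟩ | ⟨h1, h2⟩ | h1
    · rcases le_total (2 / 3 * y) x with h3 | h3
      · refine (h₂ τ α M N hτ0 hα hM hNM).trans ?_
        rw [← hx, ex, ey]
        exact key hK₂ (by linarith) (exp_terms_le 1 (by push_cast; linarith) (by linarith)
          (by push_cast; linarith))
      · refine (h₃ τ α M N hτ0 hα hM hNM).trans ?_
        rw [← hx, ex, ey]
        exact key hK₃ (by linarith) (exp_terms_le 2 (by push_cast; linarith) (by linarith)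
          (by push_cast; linarith))
    · refine (h₄ τ α M N hτ0 hα hM hNM).trans ?_
      rw [← hx, ex, ey]
      exact key hK₄ (by linarith) (exp_terms_le 3 (by push_cast; linarith) (by linarith)
        (by push_cast; linarith))
    · calc _ ≤ (N : ℝ) := norm_expSum_le _ _
        _ ≤ M := by exact_mod_cast hNM
        _ = 1 * 1 * Real.exp x := by rw [ex]; ring
        _ ≤ _ := by gcongr <;> linarith
  · have hτM : τ ≤ M := by rw [ex, ey]; exact Real.exp_le_exp.2 hxy.le
    have hxy' : x ≤ 2 * y + Real.log 2 := by
      rw [hx, hy]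
      refine (Real.log_le_log (by linarith) hMτ).trans (le_of_eq ?_)
      rw [Real.log_mul (by norm_num) (by positivity), Real.log_pow]; push_cast; ring
    have h2 : x - y ≤ E + Real.log 2 := by
      have := mul_nonneg (subconvexExponent_nonneg σ) hy0
      have : 0 < Real.log 2 := Real.log_pos (by norm_num)
      nlinarith
    calc _ ≤ 24 * (M / τ) := norm_expSum_logPhase_le_div hτ0 hα hM hNM hτM
      _ = 24 * Real.exp (x - y) := by rw [ex, ey, Real.exp_sub]
      _ ≤ 24 * (Real.exp E * 2) := by
        gcongr
        rw [← Real.exp_log (show (0 : ℝ) < 2 by norm_num), ← Real.exp_add]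
        exact Real.exp_le_exp.2 h2
      _ = 48 * 1 * Real.exp E := by ring
      _ ≤ _ := by gcongr <;> linarith

/-- Abel summation against a nonnegative decreasing weight. -/
lemma norm_sum_smul_le_of_antitone {w : ℕ → ℝ} (hw : Antitone w) (hw0 : ∀ n, 0 ≤ w n) {z : ℕ → ℂ}
    {B : ℝ} {N : ℕ} (hB : ∀ n ≤ N, ‖∑ i ∈ range n, z i‖ ≤ B) :
    ‖∑ n ∈ range N, w n * z n‖ ≤ w 0 * B := by
  have h : ∀ n ≤ N, ‖∑ i ∈ range n, w i * z i - w n * ∑ i ∈ range n, z i‖ ≤ (w 0 - w n) * B := by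
    intro n
    induction n with
    | zero => simp
    | succ n ih =>
      intro hn
      have e : ∑ i ∈ range (n + 1), w i * z i - w (n + 1) * ∑ i ∈ range (n + 1), z i =
          (∑ i ∈ range n, w i * z i - w n * ∑ i ∈ range n, z i) +
            ((w n - w (n + 1) : ℝ) : ℂ) * ∑ i ∈ range (n + 1), z i := by
        rw [sum_range_succ, sum_range_succ]; push_cast; ring
      rw [e]
      refine (norm_add_le _ _).trans ?_
      rw [norm_mul, Complex.norm_of_nonneg (sub_nonneg.2 (hw n.le_succ))]
      have := mul_le_mul_of_nonneg_left (hB _ hn) (sub_nonneg.2 (hw n.le_succ))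
      have := ih (by omega)
      linarith
  calc _ = ‖(∑ i ∈ range N, w i * z i - w N * ∑ i ∈ range N, z i) + w N * ∑ i ∈ range N, z i‖ := by
        rw [sub_add_cancel]
    _ ≤ (w 0 - w N) * B + w N * B := by
        refine (norm_add_le _ _).trans (add_le_add (h N le_rfl) ?_)
        rw [norm_mul, Complex.norm_of_nonneg (hw0 N)]
        exact mul_le_mul_of_nonneg_left (hB N le_rfl) (hw0 N)
    _ = _ := by ring

private lemma ofReal_cpow_neg_eq {x : ℝ} (hx : 0 < x) (σ t : ℝ) :
    (x : ℂ) ^ (-(σ + t * Complex.I)) =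
      (x ^ (-σ) : ℝ) * Complex.exp ((-(t * Real.log x) : ℝ) * Complex.I) := by
  rw [neg_add, Complex.cpow_add _ _ (by exact_mod_cast hx.ne'), Complex.ofReal_cpow hx.le,
    Complex.cpow_def_of_ne_zero (x := (x : ℂ)) (y := -(t * Complex.I))
      (by exact_mod_cast hx.ne'), ← Complex.ofReal_log hx.le]
  push_cast
  ring_nf

/-- Bound for a block of `∑ (m + α)^(-s)` of length at most `2 |t| ^ 2`. -/
lemma exists_norm_sum_cpow_block_le :
    ∃ K : ℝ, 0 ≤ K ∧ ∀ (σ t α : ℝ) (M N : ℕ), 1 / 2 ≤ σ → 1 ≤ |t| → α ∈ Set.Icc (0 : ℝ) 1 →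
      1 ≤ M → N ≤ M → (M : ℝ) ≤ 2 * t ^ 2 →
      ‖∑ n ∈ range N, ((M + α + n : ℝ) : ℂ) ^ (-(σ + t * Complex.I))‖ ≤
        K * (1 + Real.log M) * |t| ^ subconvexExponent σ := by
  obtain ⟨K, hK, h⟩ := exists_norm_expSum_logPhase_le
  refine ⟨K, hK, fun σ t α M N hσ ht hα hM hNM hMt => ?_⟩
  have hM' : (1 : ℝ) ≤ M := by exact_mod_cast hM
  have hpos : ∀ n : ℕ, (0 : ℝ) < M + α + n := fun n => by
    have := hα.1
    positivity
  have hw : Antitone fun n : ℕ => (M + α + n : ℝ) ^ (-σ) := by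
    intro m n hmn
    have : (m : ℝ) ≤ n := by exact_mod_cast hmn
    exact Real.rpow_le_rpow_of_nonpos (hpos m) (by linarith) (by linarith)
  have hS : ∀ n ≤ N, ‖∑ i ∈ range n,
      Complex.exp ((-(t * Real.log (M + α + i)) : ℝ) * Complex.I)‖ ≤
        K * (1 + Real.log M) * ((M : ℝ) ^ σ * |t| ^ subconvexExponent σ) := by
    intro n hn
    refine le_trans (le_of_eq ?_) (h σ |t| α M n hσ ht hα hM (hn.trans hNM) (by rwa [sq_abs]))
    rcases abs_choice t with e | e
    · rw [e, ← norm_expSum_neg]; rfl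
    · rw [e]; simp only [expSum, logPhase, neg_mul]
  have := norm_sum_smul_le_of_antitone hw (fun n => (Real.rpow_pos_of_pos (hpos n) _).le) hS
  simp only [ofReal_cpow_neg_eq (hpos _)]
  refine this.trans ?_
  have hlog := Real.log_nonneg hM'
  calc ((M + α + (0 : ℕ) : ℝ) ^ (-σ)) * (K * (1 + Real.log M) * ((M : ℝ) ^ σ *
        |t| ^ subconvexExponent σ))
      ≤ (M : ℝ) ^ (-σ) * (K * (1 + Real.log M) * ((M : ℝ) ^ σ *
        |t| ^ subconvexExponent σ)) := by
        refine mul_le_mul_of_nonneg_right ?_ (by positivity)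
        exact Real.rpow_le_rpow_of_nonpos (by linarith)
          (by push_cast; linarith [hα.1]) (by linarith)
    _ = ((M : ℝ) ^ (-σ) * (M : ℝ) ^ σ) * (K * (1 + Real.log M) * |t| ^ subconvexExponent σ) := by
        ring
    _ = _ := by rw [← Real.rpow_add (by linarith)]; simp

/-- The defect `x ^ (-s) - ∫ u in x..x+1, u ^ (-s)`. -/
noncomputable def integralDefect (x : ℝ) (s : ℂ) : ℂ :=
  (x : ℂ) ^ (-s) - (((x + 1 : ℝ) : ℂ) ^ (-s + 1) / (-s + 1) - (x : ℂ) ^ (-s + 1) / (-s + 1))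

lemma norm_integralDefect_le {x : ℝ} (hx : 0 < x) {s : ℂ} (hs : 0 < s.re) (hs1 : s ≠ 1) :
    ‖integralDefect x s‖ ≤ ‖s‖ * x ^ (-s.re - 1) := by
  have hs0 : s ≠ 0 := fun h => by simp [h] at hs
  have h1 : ∀ u ∈ Set.Icc x (x + 1), ‖(x : ℂ) ^ (-s) - (u : ℂ) ^ (-s)‖ ≤
      ‖s‖ * x ^ (-s.re - 1) := by
    intro u hu
    have hd : ∀ v ∈ Set.Icc x (x + 1), HasDerivWithinAt (fun v : ℝ => (v : ℂ) ^ (-s))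
        (-s * (v : ℂ) ^ (-s - 1)) (Set.Icc x (x + 1)) v := by
      intro v hv
      have hv0 : v ≠ 0 := by linarith [hv.1]
      exact (hasDerivAt_ofReal_cpow_const hv0 (neg_ne_zero.2 hs0)).hasDerivWithinAt
    have hb : ∀ v ∈ Set.Icc x (x + 1), ‖-s * (v : ℂ) ^ (-s - 1)‖ ≤ ‖s‖ * x ^ (-s.re - 1) := by
      intro v hv
      rw [norm_mul, norm_neg, Complex.norm_cpow_eq_rpow_re_of_pos (by linarith [hv.1])]
      gcongr
      simp only [Complex.sub_re, Complex.neg_re, Complex.one_re]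
      exact Real.rpow_le_rpow_of_nonpos hx hv.1 (by linarith)
    have := (convex_Icc x (x + 1)).norm_image_sub_le_of_norm_hasDerivWithin_le hd hb hu
      (Set.left_mem_Icc.2 (by linarith))
    refine this.trans (mul_le_of_le_one_right (by positivity) ?_)
    rw [Real.norm_eq_abs, abs_le]
    constructor <;> linarith [hu.1, hu.2]
  have hd : ∀ v ∈ Set.Icc x (x + 1), HasDerivWithinAt
      (fun v : ℝ => (x : ℂ) ^ (-s) * v - (v : ℂ) ^ (-s + 1) / (-s + 1))
      ((x : ℂ) ^ (-s) - (v : ℂ) ^ (-s)) (Set.Icc x (x + 1)) v := by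
    intro v hv
    have hv0 : v ≠ 0 := by linarith [hv.1]
    have h2 := hasDerivAt_ofReal_cpow_const' hv0 (r := -s)
      (by intro h; apply hs1; linear_combination -h)
    have h3 := ((hasDerivAt_id v).ofReal_comp.const_mul ((x : ℂ) ^ (-s))).sub h2
    simp only [Complex.ofReal_one, mul_one] at h3
    exact h3.hasDerivWithinAt
  have := (convex_Icc x (x + 1)).norm_image_sub_le_of_norm_hasDerivWithin_le hd h1
    (Set.left_mem_Icc.2 (by linarith)) (Set.right_mem_Icc.2 (by linarith))
  simp only [add_sub_cancel_left, norm_one, mul_one] at this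
  refine le_trans (le_of_eq ?_) this
  rw [integralDefect]
  congr 1
  push_cast
  ring

lemma differentiableAt_integralDefect {x : ℝ} (hx : 0 < x) {s : ℂ} (hs1 : s ≠ 1) :
    DifferentiableAt ℂ (integralDefect x) s := by
  have h : -s + 1 ≠ 0 := fun h => hs1 (by linear_combination -h)
  have hx0 : (x : ℂ) ≠ 0 := by exact_mod_cast hx.ne'
  have hx1 : ((x + 1 : ℝ) : ℂ) ≠ 0 := by exact_mod_cast (by linarith : x + 1 ≠ 0)
  have e1 : DifferentiableAt ℂ (fun z : ℂ => -z) s := by fun_prop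
  have e2 : DifferentiableAt ℂ (fun z : ℂ => -z + 1) s := by fun_prop
  unfold integralDefect
  exact (e1.const_cpow (Or.inl hx0)).sub (((e2.const_cpow (Or.inl hx1)).div e2 h).sub
    ((e2.const_cpow (Or.inl hx0)).div e2 h))

/-- Euler summation of the Hurwitz series after its first `M` terms. -/
noncomputable def hurwitzEuler (α : ℝ) (M : ℕ) (s : ℂ) : ℂ :=
  ∑ m ∈ range M, ((m + α : ℝ) : ℂ) ^ (-s) - ((M + α : ℝ) : ℂ) ^ (-s + 1) / (-s + 1) +
    ∑' m : ℕ, integralDefect (M + α + m) s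

private lemma tendsto_cpow_div {x : ℝ} {s : ℂ} (hs : 1 < s.re) :
    Filter.Tendsto (fun n : ℕ => ((x + n : ℝ) : ℂ) ^ (-s + 1) / (-s + 1)) Filter.atTop (nhds 0) := by
  have hx : Filter.Tendsto (fun n : ℕ => x + (n : ℝ)) Filter.atTop Filter.atTop :=
    Filter.tendsto_atTop_add_const_left _ _ tendsto_natCast_atTop_atTop
  have h := (tendsto_rpow_neg_atTop (y := s.re - 1) (by linarith)).comp hx
  rw [← zero_div (-s + 1)]
  refine Filter.Tendsto.div_const ?_ _
  rw [tendsto_zero_iff_norm_tendsto_zero]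
  refine h.congr' ?_
  filter_upwards [hx.eventually_gt_atTop 0] with n hn
  rw [Complex.norm_cpow_eq_rpow_re_of_pos hn]
  simp only [Function.comp, Complex.add_re, Complex.neg_re, Complex.one_re]
  congr 1; ring

private lemma rpow_le_one_div {α δ : ℝ} (hα : 0 ≤ α) {M : ℕ} (hM : 1 ≤ M) (m : ℕ)
    {σ : ℝ} (hσ : δ ≤ σ) :
    (M + α + m : ℝ) ^ (-σ - 1) ≤ 1 / |(m : ℝ) + (M + α)| ^ (1 + δ) := by
  have hM' : (1 : ℝ) ≤ M := by exact_mod_cast hM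
  have h : (1 : ℝ) ≤ M + α + m := by linarith [Nat.cast_nonneg (α := ℝ) m]
  rw [add_comm (m : ℝ), abs_of_nonneg (by linarith), one_div,
    ← Real.rpow_neg (by linarith)]
  exact Real.rpow_le_rpow_of_exponent_le h (by linarith)

lemma hurwitzZeta_eq_hurwitzEuler_of_one_lt_re {α : ℝ} (hα : α ∈ Set.Ioc (0 : ℝ) 1) {M : ℕ}
    (hM : 1 ≤ M) {s : ℂ} (hs : 1 < s.re) :
    HurwitzZeta.hurwitzZeta (α : UnitAddCircle) s = hurwitzEuler α M s := by
  have hs1 : s ≠ 1 := fun h => by simp [h] at hs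
  have hx : ∀ m : ℕ, 0 < (M + α + m : ℝ) := fun m => by have := hα.1; positivity
  have h1 : HasSum (fun n : ℕ => ((n + α : ℝ) : ℂ) ^ (-s))
      (HurwitzZeta.hurwitzZeta (α : UnitAddCircle) s) := by
    convert HurwitzZeta.hasSum_hurwitzZeta_of_one_lt_re ⟨hα.1.le, hα.2⟩ hs using 2 with n
    rw [Complex.cpow_neg, one_div]
    push_cast; rfl
  have h2 := (hasSum_nat_add_iff' M).2 h1
  have hE : Summable fun m : ℕ => integralDefect (M + α + m) s := by
    refine Summable.of_norm_bounded
      (((Real.summable_one_div_nat_add_rpow (M + α) (1 + 1)).2 (by norm_num)).mul_left ‖s‖)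
      fun m => (norm_integralDefect_le (hx m) (by linarith) hs1).trans ?_
    gcongr
    exact rpow_le_one_div hα.1.le hM m hs.le
  obtain ⟨g, hg⟩ : ∃ g : ℕ → ℂ, g = fun n : ℕ => ((M + α + n : ℝ) : ℂ) ^ (-s + 1) / (-s + 1) :=
    ⟨_, rfl⟩
  have h5 : ∀ m : ℕ, ((↑(m + M) + α : ℝ) : ℂ) ^ (-s) - integralDefect (M + α + m) s =
      g (m + 1) - g m := by
    intro m
    rw [integralDefect, hg]
    push_cast
    rw [show (m : ℂ) + M + α = M + α + m by ring, add_assoc ((M : ℂ) + α)]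
    ring
  have h3 := h2.summable.sub hE
  have h4 := h3.hasSum.tendsto_sum_nat
  simp only [h5, sum_range_sub] at h4
  have h6 := tendsto_nhds_unique h4 ((hg ▸ tendsto_cpow_div hs : Filter.Tendsto g _ _).sub_const (g 0))
  simp only [← h5] at h6
  rw [h2.summable.tsum_sub hE, h2.tsum_eq, hg] at h6
  rw [hurwitzEuler]
  simp only [Nat.cast_zero, add_zero, zero_sub] at h6
  linear_combination h6

lemma hurwitzZeta_eq_hurwitzEuler {α : ℝ} (hα : α ∈ Set.Ioc (0 : ℝ) 1) {M : ℕ} (hM : 1 ≤ M) {s : ℂ}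
    (hs : 0 < s.re) (hs' : s.im ≠ 0) :
    HurwitzZeta.hurwitzZeta (α : UnitAddCircle) s = hurwitzEuler α M s := by
  have hx : ∀ m : ℕ, 0 < (M + α + m : ℝ) := fun m => by have := hα.1; positivity
  set U : Set ℂ := {z | s.re / 2 < z.re} ∩ {z | 0 < s.im * z.im} ∩ Metric.ball 0 (‖s‖ + 3) with hU
  have hUo : IsOpen U := ((isOpen_lt continuous_const Complex.continuous_re).inter
    (isOpen_lt continuous_const (continuous_const.mul Complex.continuous_im))).inter
      Metric.isOpen_ball
  have hUc : Convex ℝ U := by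
    refine Convex.inter (Convex.inter (convex_halfSpace_re_gt _) ?_) (convex_ball _ _)
    exact convex_halfSpace_gt (f := fun z : ℂ => s.im * z.im)
      ⟨fun x y => by simp; ring, fun c x => by simp; ring⟩ 0
  have hU1 : ∀ z ∈ U, z ≠ 1 := by
    rintro z hz rfl
    simpa using hz.1.2
  have hU0 : ∀ z ∈ U, 0 < z.re := fun z hz => (half_pos hs).trans hz.1.1
  have hsU : s ∈ U := by
    refine ⟨⟨?_, ?_⟩, ?_⟩
    · exact half_lt_self hs
    · exact mul_self_pos.2 hs'
    · simp
  have hsU2 : s + 2 ∈ U := by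
    refine ⟨⟨?_, ?_⟩, ?_⟩
    · change s.re / 2 < (s + 2).re
      simp only [Complex.add_re, Complex.re_ofNat]; linarith
    · change 0 < s.im * (s + 2).im
      simpa using hs'
    · rw [mem_ball_zero_iff]
      refine (norm_add_le _ _).trans_lt ?_
      norm_num
  have hD : DifferentiableOn ℂ (fun z => ∑' m : ℕ, integralDefect (M + α + m) z) U := by
    refine Complex.differentiableOn_tsum_of_summable_norm
      (((Real.summable_one_div_nat_add_rpow (M + α) (1 + s.re / 2)).2 (by linarith)).mul_left
        (‖s‖ + 3)) (fun m z hz => (differentiableAt_integralDefect (hx m)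
          (hU1 z hz)).differentiableWithinAt) hUo fun m z hz => ?_
    refine (norm_integralDefect_le (hx m) (hU0 z hz) (hU1 z hz)).trans ?_
    refine mul_le_mul ?_ ?_ (Real.rpow_nonneg (hx m).le _) (by positivity)
    · exact (mem_ball_zero_iff.1 hz.2).le
    · exact rpow_le_one_div hα.1.le hM m (le_of_lt hz.1.1)
  have hF : DifferentiableOn ℂ (hurwitzEuler α M) U := by
    refine DifferentiableOn.add (DifferentiableOn.sub ?_ ?_) hD
    · refine DifferentiableOn.fun_sum fun m _ => fun z hz => ?_
      refine (DifferentiableAt.const_cpow (by fun_prop) (Or.inl ?_)).differentiableWithinAt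
      have : (0 : ℝ) < m + α := by have := hα.1; positivity
      exact_mod_cast this.ne'
    · intro z hz
      refine (DifferentiableAt.div (DifferentiableAt.const_cpow (by fun_prop) (Or.inl ?_))
        (by fun_prop) fun h => hU1 z hz (by linear_combination -h)).differentiableWithinAt
      have : (0 : ℝ) < M + α := by have := hα.1; positivity
      exact_mod_cast this.ne'
  have hH : DifferentiableOn ℂ (HurwitzZeta.hurwitzZeta (α : UnitAddCircle)) U := fun z hz =>
    (HurwitzZeta.differentiableAt_hurwitzZeta _ (hU1 z hz)).differentiableWithinAt
  refine (hH.analyticOnNhd hUo).eqOn_of_preconnected_of_eventuallyEq (hF.analyticOnNhd hUo)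
    hUc.isPreconnected hsU2 ?_ hsU
  have : ∀ᶠ z : ℂ in nhds (s + 2), 1 < z.re :=
    (isOpen_lt continuous_const Complex.continuous_re).mem_nhds (by
      change 1 < (s + 2).re
      simp only [Complex.add_re, Complex.re_ofNat]; linarith)
  filter_upwards [this] with z hz using hurwitzZeta_eq_hurwitzEuler_of_one_lt_re hα hM hz

private lemma rpow_neg_three_halves_le {x : ℝ} (hx : 1 ≤ x) :
    x ^ (-(3 / 2) : ℝ) ≤ 6 * (1 / √x - 1 / √(x + 1)) := by
  obtain ⟨p, hp⟩ : ∃ p, p = √x := ⟨_, rfl⟩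
  obtain ⟨q, hq⟩ : ∃ q, q = √(x + 1) := ⟨_, rfl⟩
  have hp1 : 1 ≤ p := by rw [hp]; exact Real.one_le_sqrt.2 hx
  have hp2 : p ^ 2 = x := by rw [hp]; exact Real.sq_sqrt (by linarith)
  have hq2 : q ^ 2 = x + 1 := by rw [hq]; exact Real.sq_sqrt (by linarith)
  have hq0 : 0 < q := by rw [hq]; exact Real.sqrt_pos.2 (by linarith)
  have e : x ^ (-(3 / 2) : ℝ) = 1 / p ^ 3 := by
    rw [Real.rpow_neg (by linarith), one_div, ← hp2, ← Real.rpow_natCast_mul (by linarith)]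
    norm_num
  have hqp : q ≤ 3 / 2 * p := by nlinarith
  have e2 : 1 / p - 1 / q = 1 / (p * q * (p + q)) := by
    field_simp
    nlinarith
  rw [e, ← hp, ← hq, e2, mul_one_div, div_le_div_iff₀ (by positivity) (by positivity), one_mul]
  nlinarith [mul_le_mul_of_nonneg_left hqp (by positivity : 0 ≤ p * p),
    mul_le_mul_of_nonneg_left (show q ^ 2 ≤ 2 * p ^ 2 by nlinarith) (by positivity : 0 ≤ p)]

private lemma hasSum_sqrt_sub {x : ℝ} (hx : 1 ≤ x) :
    HasSum (fun m : ℕ => 6 * (1 / √(x + m) - 1 / √(x + m + 1))) (6 / √x) := by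
  rw [hasSum_iff_tendsto_nat_of_nonneg]
  · obtain ⟨g, hg⟩ : ∃ g : ℕ → ℝ, g = fun m : ℕ => 1 / √(x + m) := ⟨_, rfl⟩
    have h : ∀ m : ℕ, 6 * (1 / √(x + m) - 1 / √(x + m + 1)) = 6 * (g m - g (m + 1)) := fun m => by
      rw [hg]; push_cast; rw [add_assoc]
    simp only [h, ← mul_sum, sum_range_sub']
    have h1 : Filter.Tendsto g Filter.atTop (nhds 0) := by
      rw [hg]
      simp only [one_div]
      exact tendsto_inv_atTop_zero.comp (Real.tendsto_sqrt_atTop.comp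
        (Filter.tendsto_atTop_add_const_left _ _ tendsto_natCast_atTop_atTop))
    have h2 := (h1.const_sub (g 0)).const_mul 6
    have h3 : 6 * (g 0 - 0) = 6 / √x := by rw [hg]; simp [div_eq_mul_inv]
    rwa [h3] at h2
  · intro m
    exact (Real.rpow_nonneg (by positivity) _).trans
      (rpow_neg_three_halves_le (by linarith [Nat.cast_nonneg (α := ℝ) m] : 1 ≤ x + m))

lemma norm_tsum_integralDefect_le {x : ℝ} (hx : 1 ≤ x) {s : ℂ} (hs : 1 / 2 ≤ s.re) (hs1 : s ≠ 1) :
    ‖∑' m : ℕ, integralDefect (x + m) s‖ ≤ ‖s‖ * (6 / √x) := by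
  refine tsum_of_norm_bounded ((hasSum_sqrt_sub hx).mul_left ‖s‖) fun m => ?_
  have h : 1 ≤ x + m := by linarith [Nat.cast_nonneg (α := ℝ) m]
  refine (norm_integralDefect_le (by linarith) (by linarith) hs1).trans ?_
  gcongr
  exact (Real.rpow_le_rpow_of_exponent_le h (by linarith)).trans (rpow_neg_three_halves_le h)

private lemma sum_range_two_pow {E : Type*} [AddCommMonoid E] (f : ℕ → E) (k : ℕ) :
    ∑ m ∈ range (2 ^ k), f m = f 0 + ∑ j ∈ range k, ∑ n ∈ range (2 ^ j), f (2 ^ j + n) := by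
  induction k with
  | zero => simp
  | succ k ih => rw [pow_succ, mul_two, sum_range_add, ih, sum_range_succ, add_assoc]

/-- Subconvexity bound for the Hurwitz zeta function in the strip `1/2 ≤ σ ≤ 2`. -/
lemma exists_norm_hurwitzZeta_le {α : ℝ} (hα : α ∈ Set.Ioc (0 : ℝ) 1) :
    ∃ C : ℝ, 0 ≤ C ∧ ∀ σ t : ℝ, 1 / 2 ≤ σ → σ ≤ 2 → 2 ≤ |t| →
      ‖HurwitzZeta.hurwitzZeta (α : UnitAddCircle) (σ + t * Complex.I)‖ ≤
        C * ((1 + Real.log |t|) ^ 2 * |t| ^ subconvexExponent σ) := by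
  obtain ⟨K, hK, hblock⟩ := exists_norm_sum_cpow_block_le
  refine ⟨α ^ (-2 : ℝ) + 6 * K + 2 + 12, by have := hα.1; positivity, fun σ t hσ hσ2 ht => ?_⟩
  set s : ℂ := σ + t * Complex.I with hs
  have hre : s.re = σ := by simp [hs]
  have him : s.im = t := by simp [hs]
  have ht0 : 0 < |t| := by linarith
  have him0 : s.im ≠ 0 := him ▸ abs_pos.1 ht0
  have hs1 : s ≠ 1 := fun h => him0 (by simp [h])
  have hℓ0 : 0 ≤ Real.log |t| := Real.log_nonneg (by linarith)
  have hT : 1 ≤ |t| ^ subconvexExponent σ :=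
    Real.one_le_rpow (by linarith) (subconvexExponent_nonneg σ)
  obtain ⟨k, hk1, hk2⟩ := exists_nat_pow_near (x := t ^ 2) (y := 2)
    (by rw [← sq_abs]; nlinarith) (by norm_num)
  have hlog2 : Real.log (t ^ 2) = 2 * Real.log |t| := by
    rw [← sq_abs, Real.log_pow]; norm_num
  have hk : ((k + 1 : ℕ) : ℝ) ≤ 3 * (1 + Real.log |t|) := by
    have := Real.log_le_log (by positivity) hk1
    rw [Real.log_pow, hlog2] at this
    push_cast
    nlinarith [Real.log_two_gt_d9, Nat.cast_nonneg (α := ℝ) k]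
  have hM : 1 ≤ 2 ^ (k + 1) := Nat.one_le_two_pow
  have hx : (0 : ℝ) < ((2 ^ (k + 1) : ℕ) : ℝ) + α := by have := hα.1; positivity
  have hxge : |t| ≤ √(((2 ^ (k + 1) : ℕ) : ℝ) + α) := by
    refine Real.le_sqrt_of_sq_le ?_
    push_cast
    rw [sq_abs]
    linarith [hα.1]
  have hxle : √(((2 ^ (k + 1) : ℕ) : ℝ) + α) ≤ 2 * |t| := by
    rw [Real.sqrt_le_left (by positivity), mul_pow, sq_abs]
    push_cast
    rw [pow_succ]
    nlinarith [hα.2, sq_abs t]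
  have b0 : ‖(((0 : ℕ) + α : ℝ) : ℂ) ^ (-s)‖ ≤ α ^ (-2 : ℝ) := by
    rw [Nat.cast_zero, zero_add, Complex.norm_cpow_eq_rpow_re_of_pos hα.1, Complex.neg_re, hre]
    exact Real.rpow_le_rpow_of_exponent_ge hα.1 hα.2 (by linarith)
  have b1 : ∀ j ∈ range (k + 1), ‖∑ n ∈ range (2 ^ j), (((2 ^ j + n : ℕ) + α : ℝ) : ℂ) ^ (-s)‖ ≤
      2 * K * (1 + Real.log |t|) * |t| ^ subconvexExponent σ := by
    intro j hj
    have hj2 : ((2 ^ j : ℕ) : ℝ) ≤ 2 * t ^ 2 := by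
      push_cast
      have : (2 : ℝ) ^ j ≤ 2 ^ k := pow_le_pow_right₀ (by norm_num) (by simpa [Nat.lt_succ_iff] using hj)
      nlinarith [sq_nonneg t]
    have := hblock σ t α (2 ^ j) (2 ^ j) hσ (by linarith) ⟨hα.1.le, hα.2⟩ Nat.one_le_two_pow le_rfl hj2
    refine (le_of_eq ?_).trans (this.trans ?_)
    · congr 1
      refine sum_congr rfl fun n _ => ?_
      congr 2
      push_cast; ring
    · have hl : Real.log ((2 ^ j : ℕ) : ℝ) ≤ 1 + 2 * Real.log |t| := by
        refine (Real.log_le_log (by positivity) hj2).trans ?_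
        rw [Real.log_mul (by norm_num) (by rw [← sq_abs]; positivity), hlog2]
        linarith [Real.log_two_lt_d9]
      refine mul_le_mul_of_nonneg_right ?_ (by positivity)
      nlinarith
  have b2 : ‖((((2 ^ (k + 1) : ℕ) : ℝ) + α : ℝ) : ℂ) ^ (-s + 1) / (-s + 1)‖ ≤ 2 := by
    have hden : |t| ≤ ‖-s + 1‖ := by
      refine le_trans (le_of_eq ?_) (Complex.abs_im_le_norm _)
      simp [him]
    rw [norm_div, Complex.norm_cpow_eq_rpow_re_of_pos hx, div_le_iff₀ (by linarith)]
    refine le_trans ?_ (mul_le_mul_of_nonneg_left hden (by norm_num))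
    refine le_trans ?_ hxle
    rw [Real.sqrt_eq_rpow]
    refine Real.rpow_le_rpow_of_exponent_le ?_ ?_
    · have : (1 : ℝ) ≤ ((2 ^ (k + 1) : ℕ) : ℝ) := by exact_mod_cast hM
      linarith [hα.1]
    · simp [hre]; linarith
  have b3 : ‖∑' m : ℕ, integralDefect (((2 ^ (k + 1) : ℕ) : ℝ) + α + m) s‖ ≤ 12 := by
    have hx1 : 1 ≤ ((2 ^ (k + 1) : ℕ) : ℝ) + α := by
      have : (1 : ℝ) ≤ ((2 ^ (k + 1) : ℕ) : ℝ) := by exact_mod_cast hM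
      linarith [hα.1]
    have hns : ‖s‖ ≤ 2 * |t| := by
      refine (Complex.norm_le_abs_re_add_abs_im s).trans ?_
      rw [hre, him, abs_of_nonneg (by linarith : 0 ≤ σ)]
      linarith
    refine (norm_tsum_integralDefect_le hx1 (hre ▸ hσ) hs1).trans ?_
    calc _ ≤ 2 * |t| * (6 / |t|) := by gcongr
      _ = 12 := by field_simp; norm_num
  have b4 : ‖∑ j ∈ range (k + 1), ∑ n ∈ range (2 ^ j), (((2 ^ j + n : ℕ) + α : ℝ) : ℂ) ^ (-s)‖ ≤
      6 * K * ((1 + Real.log |t|) ^ 2 * |t| ^ subconvexExponent σ) := by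
    refine (norm_sum_le_of_le _ b1).trans ?_
    rw [sum_const, card_range, nsmul_eq_mul]
    calc _ ≤ 3 * (1 + Real.log |t|) * (2 * K * (1 + Real.log |t|) * |t| ^ subconvexExponent σ) := by
          gcongr
      _ = _ := by ring
  have hX : 1 ≤ (1 + Real.log |t|) ^ 2 * |t| ^ subconvexExponent σ :=
    one_le_mul_of_one_le_of_one_le (one_le_pow₀ (by linarith)) hT
  rw [hurwitzZeta_eq_hurwitzEuler hα hM (by rw [hre]; linarith) him0, hurwitzEuler,
    sum_range_two_pow]
  calc _ ≤ α ^ (-2 : ℝ) + 6 * K * ((1 + Real.log |t|) ^ 2 * |t| ^ subconvexExponent σ) + 2 + 12 :=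
        (norm_add_le _ _).trans (add_le_add ((norm_sub_le _ _).trans (add_le_add
          ((norm_add_le _ _).trans (add_le_add b0 b4)) b2)) b3)
    _ ≤ _ := by
      have : 0 ≤ α ^ (-2 : ℝ) := Real.rpow_nonneg hα.1.le _
      nlinarith

/-- Bound for Dirichlet `L`-functions in the strip `1/2 ≤ σ ≤ 2`. -/
lemma exists_norm_LFunction_le_of_le_two {a : ℕ} [NeZero a] (χ : DirichletCharacter ℂ a) :
    ∃ C : ℝ, 0 ≤ C ∧ ∀ σ t : ℝ, 1 / 2 ≤ σ → σ ≤ 2 → 2 ≤ |t| →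
      ‖DirichletCharacter.LFunction χ (σ + t * Complex.I)‖ ≤
        C * ((1 + Real.log |t|) ^ 2 * |t| ^ subconvexExponent σ) := by
  have h : ∀ j : ZMod a, ∃ C : ℝ, 0 ≤ C ∧ ∀ σ t : ℝ, 1 / 2 ≤ σ → σ ≤ 2 → 2 ≤ |t| →
      ‖HurwitzZeta.hurwitzZeta (ZMod.toAddCircle j) (σ + t * Complex.I)‖ ≤
        C * ((1 + Real.log |t|) ^ 2 * |t| ^ subconvexExponent σ) := by
    intro j
    obtain ⟨α, hα, e⟩ : ZMod.toAddCircle j ∈ ((↑) : ℝ → UnitAddCircle) '' Set.Ioc 0 (0 + 1) := by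
      rw [AddCircle.coe_image_Ioc_eq]; trivial
    rw [← e]
    exact exists_norm_hurwitzZeta_le (by simpa using hα)
  choose C hC0 hC using h
  refine ⟨∑ j, C j, sum_nonneg fun j _ => hC0 j, fun σ t hσ hσ2 ht => ?_⟩
  rw [DirichletCharacter.LFunction, ZMod.LFunction, norm_mul, sum_mul]
  have h1 : ‖(a : ℂ) ^ (-(σ + t * Complex.I))‖ ≤ 1 := by
    rw [Complex.norm_natCast_cpow_of_pos (Nat.pos_of_neZero a)]
    refine Real.rpow_le_one_of_one_le_of_nonpos ?_ ?_
    · exact_mod_cast Nat.pos_of_neZero a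
    · simp; linarith
  refine (mul_le_of_le_one_left (norm_nonneg _) h1).trans (norm_sum_le_of_le _ fun j _ => ?_)
  rw [norm_mul]
  exact (mul_le_of_le_one_left (norm_nonneg _) (χ.norm_le_one j)).trans (hC j σ t hσ hσ2 ht)

lemma exists_norm_LFunction_le_of_two_le {a : ℕ} [NeZero a] (χ : DirichletCharacter ℂ a) :
    ∃ C : ℝ, 0 ≤ C ∧ ∀ s : ℂ, 2 ≤ s.re → ‖DirichletCharacter.LFunction χ s‖ ≤ C := by
  refine ⟨∑' n, ‖LSeries.term (χ ·) 2 n‖, tsum_nonneg fun _ => norm_nonneg _, fun s hs => ?_⟩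
  rw [χ.LFunction_eq_LSeries (by linarith)]
  exact tsum_of_norm_bounded
    (χ.LSeriesSummable_of_one_lt_re (by norm_num : 1 < (2 : ℂ).re)).norm.hasSum
    fun n => LSeries.norm_term_le_of_re_le_re _ (by simpa using hs) n

private lemma one_add_log_sq_le {τ ε : ℝ} (hτ : 1 ≤ τ) (hε : 0 < ε) :
    (1 + Real.log τ) ^ 2 ≤ (1 + 2 / ε) ^ 2 * τ ^ ε := by
  have h1 := Real.log_le_rpow_div (by linarith : 0 ≤ τ) (half_pos hε)
  have h2 : 1 ≤ τ ^ (ε / 2) := Real.one_le_rpow hτ (by positivity)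
  have h3 : 1 + Real.log τ ≤ (1 + 2 / ε) * τ ^ (ε / 2) := by
    have : τ ^ (ε / 2) / (ε / 2) = 2 / ε * τ ^ (ε / 2) := by field_simp
    linarith
  calc _ ≤ ((1 + 2 / ε) * τ ^ (ε / 2)) ^ 2 :=
        pow_le_pow_left₀ (by linarith [Real.log_nonneg hτ]) h3 2
    _ = _ := by rw [mul_pow, ← Real.rpow_mul_natCast (by linarith)]; norm_num

/-- Subconvexity exponent `μ(σ)` obtained by convexity from the Pan & Pan bounds:
`L(σ + it, χ) ≪_{a,ε} |t|^{μ(σ)+ε}` uniformly for `σ ≥ 1/2` and `|t| ≥ 2`, where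
`μ(σ) = 1/6 - (4/9)(σ - 1/2)` for `1/2 ≤ σ ≤ 5/7`, `μ(σ) = (1-σ)/4` for
`5/7 < σ ≤ 1`, and `μ(σ) = 0` for `σ > 1`. -/
theorem stmt9 (a : ℕ) [NeZero a] (χ : DirichletCharacter ℂ a) (ε : ℝ) (hε : 0 < ε) :
    ∃ C : ℝ, ∀ σ t : ℝ, 1 / 2 ≤ σ → 2 ≤ |t| →
      ‖DirichletCharacter.LFunction χ (σ + t * Complex.I)‖ ≤
        C * |t| ^
          ((if σ ≤ 5 / 7 then 1 / 6 - 4 / 9 * (σ - 1 / 2)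
            else if σ ≤ 1 then (1 - σ) / 4 else 0) + ε) := by
  obtain ⟨C₁, hC₁, h₁⟩ := exists_norm_LFunction_le_of_le_two χ
  obtain ⟨C₂, hC₂, h₂⟩ := exists_norm_LFunction_le_of_two_le χ
  refine ⟨C₁ * (1 + 2 / ε) ^ 2 + C₂, fun σ t hσ ht => ?_⟩
  change _ ≤ _ * |t| ^ (subconvexExponent σ + ε)
  have h1 : 1 ≤ |t| ^ (subconvexExponent σ + ε) :=
    Real.one_le_rpow (by linarith) (by linarith [subconvexExponent_nonneg σ])
  rcases le_total σ 2 with hσ2 | hσ2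
  · calc _ ≤ _ := h₁ σ t hσ hσ2 ht
      _ ≤ C₁ * ((1 + 2 / ε) ^ 2 * |t| ^ ε * |t| ^ subconvexExponent σ) := by
        gcongr
        exact one_add_log_sq_le (by linarith) hε
      _ = C₁ * (1 + 2 / ε) ^ 2 * |t| ^ (subconvexExponent σ + ε) := by
        rw [Real.rpow_add (by linarith)]; ring
      _ ≤ _ := by gcongr; linarith
  · calc _ ≤ C₂ * 1 := by
          rw [mul_one]
          exact h₂ _ (by simpa using hσ2)
      _ ≤ _ := by gcongr; exact le_add_of_nonneg_left (by positivity)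
end

section
/- Let a and n be positive integers with gcd(n,a) = 1. Then R(n;a) equals the number of positive divisors u of n² with u ≡ −n (mod a). -/
/-- `R n a` is the number of ordered pairs `(x, y)` of positive integers
satisfying `a / n = 1 / x + 1 / y`. -/
noncomputable def R (n a : ℕ) : ℕ :=
  Nat.card {p : ℕ × ℕ | 0 < p.1 ∧ 0 < p.2 ∧ (a : ℚ) / n = 1 / p.1 + 1 / p.2}

/-- Clearing denominators in `a / n = 1 / x + 1 / y`. -/
theorem div_eq_one_div_add_one_div_iff {a n x y : ℕ} (hn : 0 < n) (hx : 0 < x) (hy : 0 < y) :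
    (a : ℚ) / n = 1 / x + 1 / y ↔ a * x * y = n * (x + y) := by
  have hn' : (n : ℚ) ≠ 0 := by positivity
  have hx' : (x : ℚ) ≠ 0 := by positivity
  have hy' : (y : ℚ) ≠ 0 := by positivity
  rw [div_add_div _ _ hx' hy', div_eq_div_iff hn' (mul_ne_zero hx' hy'), ← @Nat.cast_inj ℚ]
  push_cast
  constructor <;> intro h <;> linarith

/-- The equation `a x y = n (x + y)` forces `n < a x`. -/
theorem lt_mul_of_mul_mul_eq {a n x y : ℕ} (hn : 0 < n) (hx : 0 < x)
    (h : a * x * y = n * (x + y)) : n < a * x := by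
  have hnx : 0 < n * x := Nat.mul_pos hn hx
  by_contra! hle
  nlinarith [Nat.mul_le_mul_right y hle]

/-- Shifting by `n` turns `a x y = n (x + y)` into the factorization `u v = n²`. -/
theorem mul_mul_eq_iff_mul_eq_sq {a n x y u v : ℕ} (ha : 0 < a)
    (hu : u + n = a * x) (hv : v + n = a * y) :
    a * x * y = n * (x + y) ↔ u * v = n ^ 2 := by
  zify at *
  have ha' : (a : ℤ) ≠ 0 := ha.ne'
  have key : (u : ℤ) * v - n ^ 2 = a * (a * x * y - n * (x + y)) := by
    rw [eq_sub_of_add_eq hu, eq_sub_of_add_eq hv]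
    ring
  rw [← sub_eq_zero, ← sub_eq_zero (a := (u : ℤ) * v), key, mul_eq_zero, or_iff_right ha']

/-- If `u v = n²` with `n` prime to `a` and `u ≡ -n (mod a)`, then also `v ≡ -n (mod a)`. -/
theorem dvd_add_of_mul_eq_sq {a n u v : ℕ} (h : Nat.gcd n a = 1) (huv : u * v = n ^ 2)
    (hu : a ∣ u + n) : a ∣ v + n := by
  refine (Nat.Coprime.symm h).dvd_of_dvd_mul_left (m := n) ?_
  have e : n * (v + n) = (u + n) * v := by
    linear_combination -huv
  exact e ▸ hu.mul_right v

theorem ZMod.natCast_eq_neg_natCast_iff (a n u : ℕ) :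
    (u : ZMod a) = -(n : ZMod a) ↔ a ∣ u + n := by
  rw [eq_neg_iff_add_eq_zero, ← Nat.cast_add, ZMod.natCast_eq_zero_iff]

/-- For `gcd(n, a) = 1`, `R(n; a)` equals the number of positive divisors `u`
of `n²` with `u ≡ -n (mod a)`. -/
theorem stmt11 (a n : ℕ) (ha : 0 < a) (hn : 0 < n) (h : Nat.gcd n a = 1) :
    R n a = ((n ^ 2).divisors.filter
      (fun (u : ℕ) => ((u : ZMod a) = -(n : ZMod a)))).card := by
  rw [R, Nat.card_coe_set_eq, ← Set.ncard_coe_finset]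
  refine Set.ncard_congr (fun p _ => a * p.1 - n) ?_ ?_ ?_
  · rintro ⟨x, y⟩ ⟨hx, hy, hxy⟩
    rw [div_eq_one_div_add_one_div_iff hn hx hy] at hxy
    dsimp only at hx hy hxy
    have hu := Nat.sub_add_cancel (lt_mul_of_mul_mul_eq hn hx hxy).le
    have hv := Nat.sub_add_cancel
      (lt_mul_of_mul_mul_eq (a := a) (x := y) (y := x) hn hy (by linarith)).le
    simp only [Finset.coe_filter, Nat.mem_divisors, Set.mem_ofPred_eq,
      ZMod.natCast_eq_neg_natCast_iff]
    exact ⟨⟨⟨_, ((mul_mul_eq_iff_mul_eq_sq ha hu hv).1 hxy).symm⟩, by positivity⟩,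
      hu.symm ▸ dvd_mul_right a x⟩
  · rintro ⟨x, y⟩ ⟨x', y'⟩ ⟨hx, hy, hxy⟩ ⟨hx', hy', hxy'⟩ heq
    obtain rfl : x = x' := by
      have h₁ := lt_mul_of_mul_mul_eq hn hx
        ((div_eq_one_div_add_one_div_iff hn hx hy).1 hxy)
      have h₂ := lt_mul_of_mul_mul_eq hn hx'
        ((div_eq_one_div_add_one_div_iff hn hx' hy').1 hxy')
      dsimp only at heq h₁ h₂
      exact Nat.eq_of_mul_eq_mul_left ha (by omega)
    have hinv : (1 : ℚ) / y = 1 / y' := add_left_cancel (hxy.symm.trans hxy')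
    simpa using hinv
  · intro u hu
    simp only [Finset.coe_filter, Nat.mem_divisors, Set.mem_ofPred_eq,
      ZMod.natCast_eq_neg_natCast_iff] at hu
    obtain ⟨⟨⟨v, huv⟩, -⟩, hdvd⟩ := hu
    obtain ⟨y, hy⟩ := dvd_add_of_mul_eq_sq h huv.symm hdvd
    obtain ⟨x, hx⟩ := hdvd
    have hx0 : 0 < x := Nat.pos_of_mul_pos_left (a := a) (by omega)
    have hy0 : 0 < y := Nat.pos_of_mul_pos_left (a := a) (by omega)
    refine ⟨(x, y), ⟨hx0, hy0, ?_⟩, ?_⟩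
    · exact (div_eq_one_div_add_one_div_iff hn hx0 hy0).2
        ((mul_mul_eq_iff_mul_eq_sq ha hx hy).2 huv.symm)
    · dsimp only
      omega
end
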